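/- Poincaré–Birkhoff–Witt expansion of the canonical form, type D_r, chain part: let k∈ℕ^r with k_1 = 0 or k_2 = 0. Then, in the quotient U/I, Σ_J ω_J · f_{J(|k|)} f_{J(|k|−1)} ⋯ f_{J(1)} = Σ_p ω_p · F^p, where J ranges over all multi-indices of content k and p ranges over all maps from the set of chain roots {ε_j−ε_i : 1≤i<j≤r} ∪ {ε_1+ε_j : 2≤j≤r} to ℕ with Σ p_β·c(β) = k. (The remaining positive roots ε_j+ε_i with 2≤i<j have content with nonzero entries at both positions 1 and 2 and hence cannot contribute.) -/

import Mathlib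

open Finset
open scoped Classical

noncomputable section

/-- The set of variables `t⁽ⁱ⁾_a`, `1 ≤ i ≤ r`, `1 ≤ a ≤ k i`. -/
abbrev SVars (r : ℕ) (k : Fin r → ℕ) := (i : Fin r) × Fin (k i)

/-- The field `K` of rational functions over `ℂ` in the variables `t⁽ⁱ⁾_a`. -/
abbrev RF (r : ℕ) (k : Fin r → ℕ) := FractionRing (MvPolynomial (SVars r k) ℂ)

/-- The variable `t⁽ⁱ⁾_a` as a rational function. -/
def Xv (r : ℕ) (k : Fin r → ℕ) (v : SVars r k) : RF r k :=
  algebraMap (MvPolynomial (SVars r k) ℂ) (RF r k) (MvPolynomial.X v)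

/-- `posCount J u` is the number of `v < u` with the same color as `u`; under the
identification of the paper, `t_u = t^{(J(u))}_{posCount J u + 1}`. -/
def posCount {r n : ℕ} (J : Fin n → Fin r) (u : Fin n) : ℕ :=
  (univ.filter fun v => J v = J u ∧ v < u).card

/-- The chain variable `t_u` (with `t_0 = 0`) as a rational function, after applying the
permutation `π ∈ G_k`. -/
def chainRF (r : ℕ) (k : Fin r → ℕ) {n : ℕ} (J : Fin n → Fin r)
    (π : ∀ i, Equiv.Perm (Fin (k i))) : ℕ → RF r k
  | 0 => 0
  | (u + 1) =>
    if h : u < n then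
      if h2 : posCount J ⟨u, h⟩ < k (J ⟨u, h⟩) then
        Xv r k ⟨J ⟨u, h⟩, π (J ⟨u, h⟩) ⟨posCount J ⟨u, h⟩, h2⟩⟩
      else 0
    else 0

/-- The canonical coefficient function
`ω_J = Σ_{π ∈ G_k} π·(∏_{u=1}^{n} 1/(t_u − t_{u−1}))` as a rational function. -/
def omegaRF (r : ℕ) (k : Fin r → ℕ) {n : ℕ} (J : Fin n → Fin r) : RF r k :=
  ∑ π : ∀ i, Equiv.Perm (Fin (k i)),
    ∏ u ∈ range n, (chainRF r k J π (u + 1) - chainRF r k J π u)⁻¹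

/-- `J` is a multi-index of content `k`. -/
def IsContent (r : ℕ) {n : ℕ} (J : Fin n → Fin r) (k : Fin r → ℕ) : Prop :=
  ∀ i : Fin r, (univ.filter fun v => J v = i).card = k i

/-- The free associative `K`-algebra `U` on the generators `f_1, …, f_r`. -/
abbrev FreeA (r : ℕ) (k : Fin r → ℕ) := FreeAlgebra (RF r k) (Fin r)

/-- The generator `f_{u+1}` (`0`-based index `u`). -/
def fgen (r : ℕ) (k : Fin r → ℕ) (u : ℕ) : FreeA r k :=
  if h : u < r then FreeAlgebra.ι (RF r k) ⟨u, h⟩ else 0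

/-- The commutator `[a, b] = ab − ba`. -/
def lieBr {A : Type*} [Ring A] (a b : A) : A := a * b - b * a

/-- The iterated bracket `[f_{a_1}, [f_{a_2}, [… , f_{a_s}]…]]` (0-based indices). -/
def listBracket (r : ℕ) (k : Fin r → ℕ) : List ℕ → FreeA r k
  | [] => 0
  | [a] => fgen r k a
  | a :: b :: l => lieBr (fgen r k a) (listBracket r k (b :: l))

/-- The monomial `f_{J(n)} f_{J(n−1)} ⋯ f_{J(1)}`. -/
def monJ (r : ℕ) (k : Fin r → ℕ) {n : ℕ} (J : Fin n → Fin r) : FreeA r k :=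
  (List.ofFn fun u : Fin n => FreeAlgebra.ι (RF r k) (J u.rev)).prod

/-- Adjacency in the `D_r` Dynkin diagram (0-based nodes; edges `{0,2}`, `{1,2}`,
`{u, u+1}` for `2 ≤ u ≤ r−2`). -/
def adjD (r : ℕ) (a b : Fin r) : Prop :=
  (min (a : ℕ) (b : ℕ) = 0 ∧ max (a : ℕ) (b : ℕ) = 2) ∨
  (min (a : ℕ) (b : ℕ) = 1 ∧ max (a : ℕ) (b : ℕ) = 2) ∨
  (2 ≤ min (a : ℕ) (b : ℕ) ∧ max (a : ℕ) (b : ℕ) = min (a : ℕ) (b : ℕ) + 1)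

/-- The Serre elements of type `D_r`: `[f_a, f_b]` for non-adjacent pairs `a ≠ b`, and
`[f_a, [f_a, f_b]]` for adjacent pairs. -/
def serreD (r : ℕ) (k : Fin r → ℕ) : Set (FreeA r k) :=
  {x | ∃ a b : Fin r, a ≠ b ∧ ¬adjD r a b ∧
      x = lieBr (FreeAlgebra.ι (RF r k) a) (FreeAlgebra.ι (RF r k) b)} ∪
  {x | ∃ a b : Fin r, adjD r a b ∧
      x = lieBr (FreeAlgebra.ι (RF r k) a)
        (lieBr (FreeAlgebra.ι (RF r k) a) (FreeAlgebra.ι (RF r k) b))}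

/-- The chain roots of `D_r`: `ε_j − ε_i` for `1 ≤ i < j ≤ r` (encoded by the 0-based
pair `(i−1, j−1)`), and `ε_1 + ε_j` for `2 ≤ j ≤ r` (encoded by the 0-based index
`j−1 ≥ 1`). -/
abbrev RootD (r : ℕ) :=
  {q : Fin r × Fin r // q.1 < q.2} ⊕ {v : Fin r // 0 < (v : ℕ)}

/-- The content of a chain root: for `ε_j − ε_i`, the indicator of the 1-based colors
`{i+1, …, j}`; for `ε_1 + ε_j`, the indicator of `{1} ∪ {3, …, j}`. -/
def contD (r : ℕ) (β : RootD r) : Fin r → ℕ :=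
  match β with
  | .inl q => fun u => if (q.1.1 : ℕ) < (u : ℕ) ∧ (u : ℕ) ≤ (q.1.2 : ℕ) then 1 else 0
  | .inr v => fun u => if (u : ℕ) = 0 ∨ (2 ≤ (u : ℕ) ∧ (u : ℕ) ≤ (v : ℕ)) then 1 else 0

/-- The second (1-based) index `j` of a chain root. -/
def jIdxD (r : ℕ) (β : RootD r) : ℕ :=
  match β with
  | .inl q => (q.1.2 : ℕ) + 1
  | .inr v => (v : ℕ) + 1

/-- The tie-breaking key: `ε_1 + ε_j` comes first, then the `ε_j − ε_i` in increasing
order of `i`. -/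
def subIdxD (r : ℕ) (β : RootD r) : ℕ :=
  match β with
  | .inl q => (q.1.1 : ℕ) + 1
  | .inr _ => 0

/-- The order on the chain roots: by `j` increasing, then `ε_1+ε_j` first, then the
`ε_j−ε_i` by `i` increasing. -/
def beforeD (r : ℕ) (β β' : RootD r) : Prop :=
  jIdxD r β < jIdxD r β' ∨ (jIdxD r β = jIdxD r β' ∧ subIdxD r β < subIdxD r β')

/-- The offset of the color-`u` block of variables of the `c`-th copy of `η_β` inside
the star product defining `ω_p`. -/
def offD (r : ℕ) (p : RootD r → ℕ) (β : RootD r) (c : ℕ) (u : Fin r) : ℕ :=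
  (∑ β' ∈ univ.filter (fun x => beforeD r x β), p β' * contD r β' u) + c * contD r β u

/-- The variable lookup for the `c`-th copy of the factor `η_β` in `ω_p` (1-based color
`u` and lower index `a`), after the global permutation `π ∈ G_k`. -/
def tvD (r : ℕ) (k : Fin r → ℕ) (p : RootD r → ℕ) (π : ∀ i, Equiv.Perm (Fin (k i)))
    (β : RootD r) (c : ℕ) (u a : ℕ) : RF r k :=
  if h : u - 1 < r then
    if h2 : offD r p β c ⟨u - 1, h⟩ + (a - 1) < k ⟨u - 1, h⟩ then
      Xv r k ⟨⟨u - 1, h⟩, π ⟨u - 1, h⟩ ⟨offD r p β c ⟨u - 1, h⟩ + (a - 1), h2⟩⟩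
    else 0
  else 0

/-- The functions `η_{ε_j−ε_i} = 1/(t⁽ⁱ⁺¹⁾ ∏_{u=i+2}^{j}(t⁽ᵘ⁾−t⁽ᵘ⁻¹⁾))` and
`η_{ε_1+ε_j} = 1/(t⁽¹⁾(t⁽³⁾−t⁽¹⁾) ∏_{u=4}^{j}(t⁽ᵘ⁾−t⁽ᵘ⁻¹⁾))` (`η_{ε_1+ε_2} = 1/t⁽¹⁾`),
with 1-based indices, evaluated on the variables of the `c`-th copy of `η_β` in `ω_p`. -/
def etaD (r : ℕ) (k : Fin r → ℕ) (p : RootD r → ℕ) (π : ∀ i, Equiv.Perm (Fin (k i)))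
    (β : RootD r) (c : ℕ) : RF r k :=
  match β with
  | .inl q =>
      (tvD r k p π (.inl q) c ((q.1.1 : ℕ) + 2) 1)⁻¹ *
        ∏ u ∈ Finset.Icc ((q.1.1 : ℕ) + 3) ((q.1.2 : ℕ) + 1),
          (tvD r k p π (.inl q) c u 1 - tvD r k p π (.inl q) c (u - 1) 1)⁻¹
  | .inr v =>
      if (v : ℕ) = 1 then (tvD r k p π (.inr v) c 1 1)⁻¹
      else
        (tvD r k p π (.inr v) c 1 1)⁻¹ *
          (tvD r k p π (.inr v) c 3 1 - tvD r k p π (.inr v) c 1 1)⁻¹ *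
          ∏ u ∈ Finset.Icc 4 ((v : ℕ) + 1),
            (tvD r k p π (.inr v) c u 1 - tvD r k p π (.inr v) c (u - 1) 1)⁻¹

/-- The coefficient `ω_p = (1/∏_β p_β!)·(star product of `p_β` copies of `η_β` over the
chain roots in increasing order)`, written out as a single symmetrization. -/
def omegaP (r : ℕ) (k : Fin r → ℕ) (p : RootD r → ℕ) : RF r k :=
  ((∏ β : RootD r, (p β).factorial : ℕ) : RF r k)⁻¹ *
    ∑ π : ∀ i, Equiv.Perm (Fin (k i)),
      ∏ β : RootD r, ∏ c ∈ range (p β), etaD r k p π β c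

/-- `p` at the root `ε_j − ε_i`, read off from the 0-based pair `(i−1, j−1)`. -/
def pMinusD (r : ℕ) (p : RootD r → ℕ) (i j : ℕ) : ℕ :=
  if h : i < r ∧ j < r ∧ i < j then
    p (.inl ⟨(⟨i, h.1⟩, ⟨j, h.2.1⟩), by exact Fin.mk_lt_mk.mpr h.2.2⟩)
  else 0

/-- `p` at the root `ε_1 + ε_j`, read off from the 0-based index `j−1`. -/
def pPlusD (r : ℕ) (p : RootD r → ℕ) (j : ℕ) : ℕ :=
  if h : j < r ∧ 0 < j then p (.inr ⟨⟨j, h.1⟩, h.2⟩) else 0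

/-- `F_{ε_j−ε_i} = [f_j, [f_{j−1}, […, f_{i+1}]…]]` (1-based; 0-based generator indices
`j−1, …, i`). -/
def FminusD (r : ℕ) (k : Fin r → ℕ) (i j : ℕ) : FreeA r k :=
  listBracket r k ((List.range' (i + 1) (j - i)).reverse)

/-- `F_{ε_1+ε_j} = [f_j, [f_{j−1}, […, [f_4, [f_3, f_1]]…]]]` (1-based; 0-based
generator indices `j−1, …, 2, 0`; in particular `F_{ε_1+ε_2} = f_1`). -/
def FplusD (r : ℕ) (k : Fin r → ℕ) (j : ℕ) : FreeA r k :=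
  listBracket r k ((List.range' 2 (j - 1)).reverse ++ [0])

/-- The PBW monomial `F^p`: the product of the `F_β^{p_β}` over the chain roots in
increasing order (smallest leftmost). -/
def FpowD (r : ℕ) (k : Fin r → ℕ) (p : RootD r → ℕ) : FreeA r k :=
  ((List.range' 1 (r - 1)).map fun j =>
    FplusD r k j ^ pPlusD r p j *
      ((List.range j).map fun i => FminusD r k i j ^ pMinusD r p i j).prod).prod

section SquarefreeCoefficients

variable {K V Y : Type*} [Field K] [DecidableEq V] [CommRing Y] [Algebra K Y]

/-- The squarefree exponent vector with support `S`. -/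
def sqfreeExp (S : Finset V) : V →₀ ℕ := Finsupp.indicator S fun _ _ => 1

lemma sqfreeExp_apply (S : Finset V) (v : V) : sqfreeExp S v = if v ∈ S then 1 else 0 := by
  simp [sqfreeExp, Finsupp.indicator_apply]

lemma sqfreeExp_support (S : Finset V) : (sqfreeExp S).support = S := by
  ext v; simp [sqfreeExp_apply]

lemma sqfreeExp_eq_zero_iff (S : Finset V) : sqfreeExp S = 0 ↔ S = ∅ := by
  rw [← Finsupp.support_eq_empty, sqfreeExp_support]

lemma sqfreeExp_sub_single (S : Finset V) (v : V) :
    sqfreeExp S - Finsupp.single v 1 = sqfreeExp (S.erase v) := by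
  ext w
  by_cases h : v = w
  · subst h; simp [sqfreeExp_apply]; split_ifs <;> simp
  · simp [sqfreeExp_apply, Ne.symm h]

/-- The coefficient of the squarefree monomial with support `S`. -/
def sqfreeCoeff (S : Finset V) : MvPolynomial V Y →ₗ[Y] Y := MvPolynomial.lcoeff Y (sqfreeExp S)

lemma sqfreeCoeff_def (S : Finset V) (f : MvPolynomial V Y) :
    sqfreeCoeff S f = f.coeff (sqfreeExp S) := rfl

lemma sqfreeCoeff_mul (S : Finset V) (f g : MvPolynomial V Y) :
    sqfreeCoeff S (f * g) = ∑ T ∈ S.powerset, sqfreeCoeff T f * sqfreeCoeff (S \ T) g := by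
  simp only [sqfreeCoeff_def, MvPolynomial.coeff_mul]
  symm
  refine Finset.sum_bij (fun T _ => (sqfreeExp T, sqfreeExp (S \ T))) ?_ ?_ ?_ ?_
  · intro T hT
    rw [HasAntidiagonal.mem_antidiagonal]
    ext v
    have : v ∈ T → v ∈ S := fun h => mem_powerset.mp hT h
    by_cases h1 : v ∈ T <;> by_cases h2 : v ∈ S <;> simp_all [sqfreeExp_apply]
  · intro T _ T' _ h
    have := congrArg (fun x => x.1.support) h
    simpa [sqfreeExp_support] using this
  · rintro ⟨a, b⟩ hab
    rw [HasAntidiagonal.mem_antidiagonal] at hab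
    have key : ∀ v, a v + b v = if v ∈ S then 1 else 0 := fun v => by
      rw [← sqfreeExp_apply, ← hab]; rfl
    refine ⟨a.support, ?_, ?_⟩
    · rw [mem_powerset]
      intro v hv
      by_contra h
      have := key v
      rw [if_neg h] at this
      rw [Finsupp.mem_support_iff] at hv
      omega
    · ext v
      · have := key v
        simp only [sqfreeExp_apply, Finsupp.mem_support_iff]
        split_ifs at * <;> omega
      · have := key v
        simp only [sqfreeExp_apply, mem_sdiff, Finsupp.mem_support_iff]
        split_ifs at * <;> grind
  · intro T _; rfl

lemma sqfreeCoeff_C (S : Finset V) (y : Y) :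
    sqfreeCoeff S (MvPolynomial.C y) = if S = ∅ then y else 0 := by
  rw [sqfreeCoeff_def, MvPolynomial.coeff_C]
  simp only [eq_comm (a := (0 : V →₀ ℕ)), sqfreeExp_eq_zero_iff]

lemma sqfreeCoeff_one (S : Finset V) :
    sqfreeCoeff S (1 : MvPolynomial V Y) = if S = ∅ then 1 else 0 := by
  rw [← MvPolynomial.C_1, sqfreeCoeff_C]

lemma sqfreeCoeff_C_mul (S : Finset V) (y : Y) (f : MvPolynomial V Y) :
    sqfreeCoeff S (MvPolynomial.C y * f) = y * sqfreeCoeff S f := by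
  simp [sqfreeCoeff_def]

lemma sqfreeCoeff_X_mul (S : Finset V) (v : V) (f : MvPolynomial V Y) :
    sqfreeCoeff S (MvPolynomial.X v * f) = if v ∈ S then sqfreeCoeff (S.erase v) f else 0 := by
  rw [sqfreeCoeff_def, MvPolynomial.coeff_X_mul', sqfreeExp_support, sqfreeExp_sub_single]
  rfl

/-- A family `f z` whose squarefree coefficients have, as functions of `z`, only simple poles at
the points `t v`, with residues read off from `g v`, and constant term `c`. -/
def HasPeel (t : V → K) (f : K → MvPolynomial V Y) (c : Y) (g : V → MvPolynomial V Y) : Prop :=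
  ∀ z S, (∀ v ∈ S, t v ≠ z) → sqfreeCoeff S (f z) =
    (if S = ∅ then c else 0) + ∑ v ∈ S, (t v - z)⁻¹ • sqfreeCoeff (S.erase v) (g v)

lemma HasPeel.mul {t : V → K} (ht : Function.Injective t) {f f' : K → MvPolynomial V Y} {c c' : Y}
    {g g' : V → MvPolynomial V Y} (h : HasPeel t f c g) (h' : HasPeel t f' c' g') :
    HasPeel t (fun z => f z * f' z) (c * c')
      (fun v => g v * f' (t v) + f (t v) * g' v) := by
  intro z S hS
  have hx : ∀ v ∈ S, t v - z ≠ 0 := fun v hv => sub_ne_zero.mpr (hS v hv)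
  have term : ∀ T ∈ S.powerset, sqfreeCoeff T (f z) * sqfreeCoeff (S \ T) (f' z) =
      (if T = ∅ ∧ S \ T = ∅ then c * c' else 0) +
      (∑ v ∈ T, (t v - z)⁻¹ • (sqfreeCoeff (T.erase v) (g v) * sqfreeCoeff (S \ T) (f' (t v))) +
       ∑ w ∈ S \ T, (t w - z)⁻¹ •
        (sqfreeCoeff T (f (t w)) * sqfreeCoeff ((S \ T).erase w) (g' w))) := by
    intro T hT
    rw [mem_powerset] at hT
    have e1 : ∀ v ∈ T, sqfreeCoeff (S \ T) (f' (t v)) = (if S \ T = ∅ then c' else 0) +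
        ∑ w ∈ S \ T, (t w - t v)⁻¹ • sqfreeCoeff ((S \ T).erase w) (g' w) := fun v hv =>
      h' _ _ fun w hw e => (mem_sdiff.mp hw).2 (ht e ▸ hv)
    have e2 : ∀ w ∈ S \ T, sqfreeCoeff T (f (t w)) = (if T = ∅ then c else 0) +
        ∑ v ∈ T, (t v - t w)⁻¹ • sqfreeCoeff (T.erase v) (g v) := fun w hw =>
      h _ _ fun v hv e => (mem_sdiff.mp hw).2 (ht e ▸ hv)
    have E1 : ∑ v ∈ T, (t v - z)⁻¹ • (sqfreeCoeff (T.erase v) (g v) *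
          sqfreeCoeff (S \ T) (f' (t v))) =
        ∑ v ∈ T, (t v - z)⁻¹ • (sqfreeCoeff (T.erase v) (g v) * ((if S \ T = ∅ then c' else 0) +
          ∑ w ∈ S \ T, (t w - t v)⁻¹ • sqfreeCoeff ((S \ T).erase w) (g' w))) :=
      sum_congr rfl fun v hv => by rw [e1 v hv]
    have E2 : ∑ w ∈ S \ T, (t w - z)⁻¹ • (sqfreeCoeff T (f (t w)) *
          sqfreeCoeff ((S \ T).erase w) (g' w)) =
        ∑ w ∈ S \ T, (t w - z)⁻¹ • (((if T = ∅ then c else 0) +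
          ∑ v ∈ T, (t v - t w)⁻¹ • sqfreeCoeff (T.erase v) (g v)) *
          sqfreeCoeff ((S \ T).erase w) (g' w)) :=
      sum_congr rfl fun w hw => by rw [e2 w hw]
    rw [h z T fun v hv => hS v (hT hv), h' z (S \ T) fun v hv => hS v (mem_sdiff.mp hv).1, E1, E2]
    have cross : ∀ v ∈ T, ∀ w ∈ S \ T, ∀ a b : Y, ((t v - z)⁻¹ • a) * ((t w - z)⁻¹ • b) =
        (t v - z)⁻¹ • (a * ((t w - t v)⁻¹ • b)) + (t w - z)⁻¹ • (((t v - t w)⁻¹ • a) * b) := by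
      intro v hv w hw a b
      have hvw : t v - t w ≠ 0 := sub_ne_zero.mpr fun e => (mem_sdiff.mp hw).2 (ht e ▸ hv)
      have hwv : t w - t v ≠ 0 := sub_ne_zero.mpr fun e => (mem_sdiff.mp hw).2 (ht e ▸ hv)
      have h1 := hx v (hT hv)
      have h2 := hx w (mem_sdiff.mp hw).1
      simp only [smul_mul_assoc, mul_smul_comm, smul_smul, ← add_smul]
      congr 1
      rw [← neg_sub (t w) (t v)] at hvw ⊢
      field_simp
      ring
    have crossSum : (∑ v ∈ T, (t v - z)⁻¹ • sqfreeCoeff (T.erase v) (g v)) *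
        (∑ w ∈ S \ T, (t w - z)⁻¹ • sqfreeCoeff ((S \ T).erase w) (g' w)) =
        ∑ v ∈ T, (t v - z)⁻¹ • (sqfreeCoeff (T.erase v) (g v) *
          ∑ w ∈ S \ T, (t w - t v)⁻¹ • sqfreeCoeff ((S \ T).erase w) (g' w)) +
        ∑ w ∈ S \ T, (t w - z)⁻¹ • ((∑ v ∈ T, (t v - t w)⁻¹ • sqfreeCoeff (T.erase v) (g v)) *
          sqfreeCoeff ((S \ T).erase w) (g' w)) := by
      rw [sum_mul_sum, sum_congr rfl fun v hv => sum_congr rfl fun w hw => cross v hv w hw _ _]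
      simp only [sum_add_distrib, mul_sum, sum_mul, smul_sum]
      congr 1
      rw [sum_comm]
    simp only [mul_add, add_mul, crossSum, smul_add, sum_add_distrib]
    have i1 : ∀ (a : Y), (∑ v ∈ T, (t v - z)⁻¹ • (sqfreeCoeff (T.erase v) (g v) * a)) =
        (∑ v ∈ T, (t v - z)⁻¹ • sqfreeCoeff (T.erase v) (g v)) * a := fun a => by
      simp only [sum_mul, smul_mul_assoc]
    have i2 : ∀ (a : Y), (∑ w ∈ S \ T, (t w - z)⁻¹ •
        (a * sqfreeCoeff ((S \ T).erase w) (g' w))) =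
        a * (∑ w ∈ S \ T, (t w - z)⁻¹ • sqfreeCoeff ((S \ T).erase w) (g' w)) := fun a => by
      simp only [mul_sum, mul_smul_comm]
    rw [i1, i2]
    by_cases hT0 : T = ∅ <;> by_cases hS0 : S \ T = ∅ <;> simp [hT0, hS0]
  rw [sqfreeCoeff_mul, sum_congr rfl term, sum_add_distrib, sum_add_distrib]
  congr 1
  · by_cases hS0 : S = ∅
    · subst hS0; simp
    · rw [if_neg hS0]
      refine sum_eq_zero fun T hT => if_neg ?_
      rintro ⟨rfl, h2⟩
      exact hS0 (by simpa using h2)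
  · simp only [map_add, smul_add, sum_add_distrib]
    congr 1
    · rw [← sum_bij (s := S.powerset) (fun T _ => S \ T) (f := fun T =>
        ∑ v ∈ S \ T, (t v - z)⁻¹ • (sqfreeCoeff ((S \ T).erase v) (g v) *
          sqfreeCoeff T (f' (t v))))]
      · rw [sum_comm' (t' := S) (s' := fun v => (S.erase v).powerset)]
        · refine sum_congr rfl fun v hv => ?_
          rw [mul_comm (g v), sqfreeCoeff_mul, smul_sum]
          refine sum_congr rfl fun T hT => ?_
          rw [mul_comm (sqfreeCoeff T _), erase_sdiff_comm]
        · intro T v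
          simp only [mem_powerset, mem_sdiff, subset_erase]
          tauto
      · intro T _; simp
      · intro T hT T' hT' e
        rw [← Finset.sdiff_sdiff_eq_self (mem_powerset.mp hT), e,
          Finset.sdiff_sdiff_eq_self (mem_powerset.mp hT')]
      · intro T hT
        exact ⟨S \ T, by simp, Finset.sdiff_sdiff_eq_self (mem_powerset.mp hT)⟩
      · intro T hT
        rw [Finset.sdiff_sdiff_eq_self (mem_powerset.mp hT)]
    · rw [sum_comm' (t' := S) (s' := fun v => (S.erase v).powerset)]
      · refine sum_congr rfl fun v hv => ?_
        rw [sqfreeCoeff_mul, smul_sum]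
        refine sum_congr rfl fun T hT => ?_
        rw [erase_sdiff_comm]
      · intro T v
        simp only [mem_powerset, mem_sdiff, subset_erase]
        tauto

end SquarefreeCoefficients

section ChainSeries

variable {K V Y : Type*} [Field K] [Fintype V] [DecidableEq V] [CommRing Y] [Algebra K Y]

/-- The generating polynomial of all chains of variables with the prescribed list of colors,
weighted by `1 / ((t_1 - z) (t_2 - t_1) ⋯)`. -/
def chainSeries (Y : Type*) [CommRing Y] [Algebra K Y] (t : V → K) (col : V → ℕ) :
    List ℕ → K → MvPolynomial V Y
  | [], _ => 1
  | a :: l, z => ∑ v, if col v = a then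
      MvPolynomial.C (algebraMap K Y (t v - z)⁻¹) *
        (MvPolynomial.X v * chainSeries Y t col l (t v)) else 0

lemma sqfreeCoeff_chainSeries_cons (t : V → K) (col : V → ℕ) (a : ℕ) (l : List ℕ) (z : K)
    (S : Finset V) : sqfreeCoeff S (chainSeries Y t col (a :: l) z) =
      ∑ v ∈ S, (t v - z)⁻¹ •
        (if col v = a then sqfreeCoeff (S.erase v) (chainSeries Y t col l (t v)) else 0) := by
  rw [chainSeries, map_sum, ← Finset.sum_subset (subset_univ S)]
  · refine sum_congr rfl fun v hv => ?_
    split_ifs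
    · rw [sqfreeCoeff_C_mul, sqfreeCoeff_X_mul, if_pos hv, Algebra.smul_def]
    · simp
  · intro v _ hv
    split_ifs
    · rw [sqfreeCoeff_C_mul, sqfreeCoeff_X_mul, if_neg hv, mul_zero]
    · simp

end ChainSeries

section RootSeries

variable {K V B : Type*} [Field K] [Fintype V] [DecidableEq V] [Fintype B] [DecidableEq B]
  (t : V → K) (col : V → ℕ) (hd : B → ℕ) (tl : B → List ℕ) (rest : B → Option B)

/-- The sum of the chain series of all roots, each marked by its own variable. -/
def rootSeries (z : K) : MvPolynomial V (MvPolynomial B K) :=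
  ∑ β : B, MvPolynomial.C (MvPolynomial.X β : MvPolynomial B K) *
    chainSeries (MvPolynomial B K) t col (hd β :: tl β) z

/-- The chain series of the roots with lowest color `a`, with that color removed. -/
def headSeries (a : ℕ) (z : K) : MvPolynomial V (MvPolynomial B K) :=
  ∑ β : B, if hd β = a then MvPolynomial.C (MvPolynomial.X β : MvPolynomial B K) *
    chainSeries (MvPolynomial B K) t col (tl β) z else 0

lemma hasPeel_rootSeries :
    HasPeel t (rootSeries t col hd tl) 0 (fun v => headSeries t col hd tl (col v) (t v)) := by
  intro z S _
  rw [rootSeries, map_sum]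
  simp only [sqfreeCoeff_C_mul, sqfreeCoeff_chainSeries_cons, headSeries, map_sum, ite_self,
    zero_add, smul_sum, mul_sum]
  rw [sum_comm]
  refine sum_congr rfl fun v _ => sum_congr rfl fun β _ => ?_
  rw [mul_smul_comm]
  congr 1
  by_cases h : col v = hd β
  · simp [h, sqfreeCoeff_C_mul]
  · simp [h, Ne.symm h]

lemma hasPeel_rootSeries_pow (ht : Function.Injective t) (n : ℕ) :
    HasPeel t (fun z => rootSeries t col hd tl z ^ (n + 1)) 0
      (fun v => (n + 1 : ℕ) • (headSeries t col hd tl (col v) (t v) *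
        rootSeries t col hd tl (t v) ^ n)) := by
  induction n with
  | zero => simpa using hasPeel_rootSeries t col hd tl
  | succ n ih =>
    have := HasPeel.mul ht ih (hasPeel_rootSeries t col hd tl)
    rw [mul_zero] at this
    convert this using 2
    rw [← pow_succ]
    simp only [nsmul_eq_mul]
    push_cast
    ring

lemma sqfreeCoeff_rootSeries_pow_eq_zero (z : K) (n : ℕ) (S : Finset V) (h : #S < n) :
    sqfreeCoeff S (rootSeries t col hd tl z ^ n) = 0 := by
  induction n generalizing S with
  | zero => omega
  | succ n ih =>
    rw [pow_succ, sqfreeCoeff_mul]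
    refine sum_eq_zero fun T hT => ?_
    by_cases hc : #T < n
    · rw [ih T hc, zero_mul]
    · have hTS : T = S := eq_of_subset_of_card_le (mem_powerset.mp hT) (by omega)
      have h0 := hasPeel_rootSeries t col hd tl z ∅ (by simp)
      rw [hTS, sdiff_self, Finset.bot_eq_empty, h0]
      simp

lemma pderiv_sqfreeCoeff_chainSeries (b : B) (l : List ℕ) (z : K) (S : Finset V) :
    MvPolynomial.pderiv b (sqfreeCoeff S (chainSeries (MvPolynomial B K) t col l z)) = 0 := by
  induction l generalizing z S with
  | nil => rw [chainSeries, sqfreeCoeff_one]; split_ifs <;> simp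
  | cons a l ih =>
    rw [sqfreeCoeff_chainSeries_cons, map_sum]
    refine sum_eq_zero fun v _ => ?_
    rw [Derivation.map_smul]
    split_ifs <;> simp [ih]

lemma pderiv_sqfreeCoeff_rootSeries_pow (b : B) (z : K) (n : ℕ) (S : Finset V) :
    MvPolynomial.pderiv b (sqfreeCoeff S (rootSeries t col hd tl z ^ (n + 1))) =
      (n + 1 : ℕ) • sqfreeCoeff S (chainSeries _ t col (hd b :: tl b) z *
        rootSeries t col hd tl z ^ n) := by
  have h1 : ∀ S : Finset V, MvPolynomial.pderiv b (sqfreeCoeff S (rootSeries t col hd tl z)) =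
      sqfreeCoeff S (chainSeries (MvPolynomial B K) t col (hd b :: tl b) z) := fun S => by
    rw [rootSeries, map_sum, map_sum, sum_eq_single b]
    · rw [sqfreeCoeff_C_mul, Derivation.leibniz, pderiv_sqfreeCoeff_chainSeries]
      simp
    · intro c _ hc
      rw [sqfreeCoeff_C_mul, Derivation.leibniz, pderiv_sqfreeCoeff_chainSeries]
      simp [MvPolynomial.pderiv_X_of_ne hc]
    · simp
  induction n generalizing S with
  | zero => simp [h1]
  | succ n ih =>
    rw [pow_succ, sqfreeCoeff_mul, map_sum]
    simp only [Derivation.leibniz, h1, ih, smul_eq_mul, sum_add_distrib]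
    rw [← sqfreeCoeff_mul]
    have e : ∀ T, sqfreeCoeff (S \ T) (rootSeries t col hd tl z) * (n + 1 : ℕ) • sqfreeCoeff T
        (chainSeries (MvPolynomial B K) t col (hd b :: tl b) z * rootSeries t col hd tl z ^ n) =
        (n + 1 : ℕ) • (sqfreeCoeff T (chainSeries (MvPolynomial B K) t col (hd b :: tl b) z *
          rootSeries t col hd tl z ^ n) * sqfreeCoeff (S \ T) (rootSeries t col hd tl z)) := by
      intro T; simp only [nsmul_eq_mul]; ring
    simp only [e, ← smul_sum]
    rw [← sqfreeCoeff_mul, ← map_nsmul, ← map_nsmul, ← map_add]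
    congr 1
    simp only [nsmul_eq_mul]
    push_cast
    ring

/-- The squarefree coefficient at `S` of the exponential of `rootSeries`, truncated at order `N`. -/
def expCoeff (N : ℕ) (z : K) (S : Finset V) : MvPolynomial B K :=
  ∑ n ∈ range (N + 1), (n.factorial : K)⁻¹ • sqfreeCoeff S (rootSeries t col hd tl z ^ n)

/-- The differential operator on commutative PBW symbols that corresponds to right multiplication
by the generator of color `a`. -/
def rootOp (a : ℕ) : MvPolynomial B K →ₗ[K] MvPolynomial B K :=
  ∑ β : B, if hd β = a then (LinearMap.mulLeft K (MvPolynomial.X β)) ∘ₗ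
    (match rest β with
      | none => LinearMap.id
      | some b => (MvPolynomial.pderiv b).toLinearMap) else 0

variable [CharZero K]

lemma rootOp_expCoeff
    (hrest : ∀ β, tl β = match rest β with | none => [] | some b => hd b :: tl b)
    (a N : ℕ) (z : K) (S : Finset V) (hS : #S < N) :
    rootOp hd rest a (expCoeff t col hd tl N z S) =
      ∑ n ∈ range N, (n.factorial : K)⁻¹ •
        sqfreeCoeff S (headSeries t col hd tl a z * rootSeries t col hd tl z ^ n) := by
  have key : ∀ β : B, (match rest β with
      | none => LinearMap.id
      | some b => ((MvPolynomial.pderiv b).toLinearMap : MvPolynomial B K →ₗ[K] MvPolynomial B K))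
        (expCoeff t col hd tl N z S) = ∑ n ∈ range N, (n.factorial : K)⁻¹ •
        sqfreeCoeff S (chainSeries _ t col (tl β) z * rootSeries t col hd tl z ^ n) := by
    intro β
    have hr := hrest β
    rcases hβ : rest β with _ | b
    · rw [hβ] at hr
      simp only at hr
      rw [hr, expCoeff, sum_range_succ, sqfreeCoeff_rootSeries_pow_eq_zero _ _ _ _ _ _ _ hS]
      simp [chainSeries]
    · rw [hβ] at hr
      simp only at hr
      rw [hr, expCoeff, sum_range_succ']
      simp only [Derivation.coeFn_coe, map_add, map_sum, map_smul,
        pderiv_sqfreeCoeff_rootSeries_pow, pow_zero, sqfreeCoeff_one]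
      have : MvPolynomial.pderiv b (if S = ∅ then (1 : MvPolynomial B K) else 0) = 0 := by
        split_ifs <;> simp
      rw [this, smul_zero, add_zero]
      refine sum_congr rfl fun n _ => ?_
      rw [← Nat.cast_smul_eq_nsmul K,
        smul_smul]
      congr 1
      rw [Nat.factorial_succ]
      have := Nat.factorial_ne_zero n
      push_cast
      field_simp
  simp only [rootOp, LinearMap.sum_apply, headSeries, sum_mul, map_sum, smul_sum]
  rw [sum_comm]
  refine sum_congr rfl fun β _ => ?_
  split_ifs with h
  · rw [LinearMap.comp_apply, key, LinearMap.mulLeft_apply, mul_sum]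
    refine sum_congr rfl fun n _ => ?_
    rw [mul_assoc, sqfreeCoeff_C_mul, mul_smul_comm]
  · simp

lemma expCoeff_peel (ht : Function.Injective t)
    (hrest : ∀ β, tl β = match rest β with | none => [] | some b => hd b :: tl b)
    (N : ℕ) (z : K) (S : Finset V) (hS : #S ≤ N) (h0 : S.Nonempty) (hz : ∀ v ∈ S, t v ≠ z) :
    expCoeff t col hd tl N z S = ∑ v ∈ S, (t v - z)⁻¹ •
      rootOp hd rest (col v) (expCoeff t col hd tl N (t v) (S.erase v)) := by
  have e : ∀ v ∈ S, rootOp hd rest (col v) (expCoeff t col hd tl N (t v) (S.erase v)) =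
      ∑ n ∈ range N, (n.factorial : K)⁻¹ • sqfreeCoeff (S.erase v)
        (headSeries t col hd tl (col v) (t v) * rootSeries t col hd tl (t v) ^ n) := fun v hv =>
    rootOp_expCoeff t col hd tl rest hrest _ _ _ _ (by
      rw [card_erase_of_mem hv]; have := card_pos.mpr h0; omega)
  rw [sum_congr rfl fun v hv => by rw [e v hv], expCoeff, sum_range_succ', pow_zero,
    sqfreeCoeff_one, if_neg h0.ne_empty, smul_zero, add_zero]
  simp only [smul_sum]
  rw [sum_comm]
  refine sum_congr rfl fun n _ => ?_
  rw [hasPeel_rootSeries_pow t col hd tl ht n z S hz, if_neg h0.ne_empty, zero_add, smul_sum]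
  refine sum_congr rfl fun v _ => ?_
  rw [map_nsmul, ← Nat.cast_smul_eq_nsmul K, smul_smul, smul_smul, smul_smul]
  congr 1
  rw [Nat.factorial_succ]
  have := Nat.factorial_ne_zero n
  push_cast
  field_simp

lemma expCoeff_empty (N : ℕ) (z : K) : expCoeff t col hd tl N z ∅ = 1 := by
  rw [expCoeff, sum_range_succ', sum_eq_zero fun n _ => by
    rw [sqfreeCoeff_rootSeries_pow_eq_zero _ _ _ _ _ _ _ (by simp), smul_zero]]
  simp [sqfreeCoeff_one]

end RootSeries

section OrderSum

variable {K V Q : Type*} [Field K] [Fintype V] [DecidableEq V] [Ring Q] [Algebra K Q]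

/-- The weight `1 / ((x_1 - z) (x_2 - x_1) ⋯ (x_n - x_{n-1}))` of a list. -/
def chainWeight : K → List K → K
  | _, [] => 1
  | z, x :: l => (x - z)⁻¹ * chainWeight x l

/-- The weighted sum of reversed words over all enumerations of `S` of length `n`. -/
def orderSum (t : V → K) (g : V → Q) (n : ℕ) (z : K) (S : Finset V) : Q :=
  ∑ e : Fin n → V, if Function.Injective e ∧ univ.image e = S then
    chainWeight z ((List.ofFn e).map t) • ((List.ofFn e).map g).reverse.prod else 0

lemma orderSum_zero (t : V → K) (g : V → Q) (z : K) : orderSum t g 0 z ∅ = 1 := by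
  simp [orderSum, chainWeight, Function.injective_of_subsingleton]

lemma injective_cons_and_image_iff {n : ℕ} (v : V) (e : Fin n → V) (S : Finset V) :
    (Function.Injective (Fin.cons v e : Fin (n + 1) → V) ∧
      univ.image (Fin.cons v e : Fin (n + 1) → V) = S) ↔
    v ∈ S ∧ Function.Injective e ∧ univ.image e = S.erase v := by
  rw [Fin.cons_injective_iff]
  have him : univ.image (Fin.cons v e : Fin (n + 1) → V) = insert v (univ.image e) := by
    ext w; simp [Fin.exists_fin_succ, eq_comm]
  rw [him]
  constructor
  · rintro ⟨⟨h1, h2⟩, rfl⟩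
    refine ⟨mem_insert_self _ _, h2, ?_⟩
    rw [erase_insert]
    simpa using h1
  · rintro ⟨h1, h2, h3⟩
    refine ⟨⟨?_, h2⟩, ?_⟩
    · rintro ⟨i, hi⟩
      have : e i ∈ S.erase v := h3 ▸ mem_image_of_mem e (mem_univ i)
      simp [hi] at this
    · rw [h3, insert_erase h1]

lemma orderSum_succ (t : V → K) (g : V → Q) (n : ℕ) (z : K) (S : Finset V) :
    orderSum t g (n + 1) z S =
      ∑ v ∈ S, (t v - z)⁻¹ • (orderSum t g n (t v) (S.erase v) * g v) := by
  rw [orderSum, ← (Fin.consEquiv fun _ => V).sum_comp, Fintype.sum_prod_type,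
    ← Finset.sum_subset (subset_univ S)]
  · refine sum_congr rfl fun v hv => ?_
    rw [orderSum, sum_mul, smul_sum]
    refine sum_congr rfl fun e _ => ?_
    change (if Function.Injective (Fin.cons v e : Fin (n + 1) → V) ∧
      univ.image (Fin.cons v e : Fin (n + 1) → V) = S then
        chainWeight z ((List.ofFn (Fin.cons v e : Fin (n + 1) → V)).map t) •
          ((List.ofFn (Fin.cons v e : Fin (n + 1) → V)).map g).reverse.prod else 0) = _
    simp only [injective_cons_and_image_iff, hv, true_and]
    split_ifs
    · simp [List.ofFn_succ, chainWeight, smul_smul]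
    · simp
  · intro v _ hv
    refine sum_eq_zero fun e _ => if_neg ?_
    exact fun h => hv ((injective_cons_and_image_iff v e S).mp h).1

end OrderSum

section PBWMap

variable {K V B Q : Type*} [Field K] [Fintype V] [DecidableEq V] [Fintype B] [DecidableEq B]
  [Ring Q] [Algebra K Q]

/-- The linear map sending the commutative monomial with exponent `p` to `Fp p`. -/
def pbwMap (K : Type*) [Field K] [Algebra K Q] (Fp : (B →₀ ℕ) → Q) : MvPolynomial B K →ₗ[K] Q :=
  (MvPolynomial.basisMonomials B K).constr K Fp

lemma pbwMap_monomial (Fp : (B →₀ ℕ) → Q) (p : B →₀ ℕ) (c : K) :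
    pbwMap K Fp (MvPolynomial.monomial p c) = c • Fp p := by
  have : MvPolynomial.monomial p c = c • MvPolynomial.basisMonomials B K p := by
    simp [MvPolynomial.smul_monomial]
  rw [this, map_smul, pbwMap, Module.Basis.constr_basis]

lemma pbwMap_rootOp (hd : B → ℕ) (rest : B → Option B) (Fp : (B →₀ ℕ) → Q) (a : ℕ) (x : Q)
    (hx : ∀ p, Fp p * x = ∑ β, if hd β = a then
      (match rest β with
        | none => Fp (p + Finsupp.single β 1)
        | some b => (p b : K) • Fp (p - Finsupp.single b 1 + Finsupp.single β 1)) else 0)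
    (y : MvPolynomial B K) : pbwMap K Fp (rootOp hd rest a y) = pbwMap K Fp y * x := by
  induction y using MvPolynomial.induction_on' with
  | add y y' h h' => rw [map_add, map_add, h, h', map_add, add_mul]
  | monomial p c =>
    rw [pbwMap_monomial, smul_mul_assoc, hx, rootOp, LinearMap.sum_apply, map_sum, smul_sum]
    refine sum_congr rfl fun β _ => ?_
    by_cases hβ : hd β = a
    · rw [if_pos hβ, if_pos hβ]
      rcases rest β with _ | b
      · simp only [LinearMap.comp_apply, LinearMap.id_apply, LinearMap.mulLeft_apply]
        rw [mul_comm, ← pow_one (MvPolynomial.X β), ← MvPolynomial.monomial_add_single,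
          pbwMap_monomial]
      · simp only [LinearMap.comp_apply, Derivation.coeFn_coe, LinearMap.mulLeft_apply,
          MvPolynomial.pderiv_monomial]
        rw [mul_comm, ← pow_one (MvPolynomial.X β), ← MvPolynomial.monomial_add_single,
          pbwMap_monomial, smul_smul]
    · simp [hβ]

theorem pbwMap_expCoeff [CharZero K] (t : V → K) (ht : Function.Injective t) (col : V → ℕ)
    (hd : B → ℕ) (tl : B → List ℕ) (rest : B → Option B)
    (hrest : ∀ β, tl β = match rest β with | none => [] | some b => hd b :: tl b)
    (Fp : (B →₀ ℕ) → Q) (hF : Fp 0 = 1) (g : V → Q)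
    (hx : ∀ v p, Fp p * g v = ∑ β, if hd β = col v then
      (match rest β with
        | none => Fp (p + Finsupp.single β 1)
        | some b => (p b : K) • Fp (p - Finsupp.single b 1 + Finsupp.single β 1)) else 0)
    (N n : ℕ) (hn : n ≤ N) (z : K) (S : Finset V) (hS : #S = n) (hz : ∀ v ∈ S, t v ≠ z) :
    pbwMap K Fp (expCoeff t col hd tl N z S) = orderSum t g n z S := by
  induction n generalizing z S with
  | zero =>
    rw [card_eq_zero] at hS
    subst hS
    rw [expCoeff_empty, orderSum_zero, ← hF]
    simpa using pbwMap_monomial Fp 0 (1 : K)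
  | succ n ih =>
    have h0 : S.Nonempty := card_pos.mp (by omega)
    rw [expCoeff_peel t col hd tl rest ht hrest N z S (by omega) h0 hz, orderSum_succ, map_sum]
    refine sum_congr rfl fun v hv => ?_
    rw [map_smul, pbwMap_rootOp hd rest Fp (col v) (g v) (hx v), ih (by omega)]
    · rw [card_erase_of_mem hv]; omega
    · intro w hw e
      exact (mem_erase.mp hw).1 (ht e)

end PBWMap

section Expansion

variable {K V B Q Y : Type*} [Field K] [Fintype V] [DecidableEq V] [Fintype B] [DecidableEq B]
  [Ring Q] [Algebra K Q] [CommRing Y] [Algebra K Y]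

lemma sqfreeCoeff_univ_prod_X {ι : Type*} [Fintype ι] (e : ι → V) :
    sqfreeCoeff univ (∏ i, MvPolynomial.X (e i) : MvPolynomial V Y) =
      if Function.Bijective e then 1 else 0 := by
  have h1 : (∏ i, MvPolynomial.X (e i) : MvPolynomial V Y) =
      MvPolynomial.monomial (∑ i, Finsupp.single (e i) 1) 1 := by
    rw [MvPolynomial.monomial_sum_one]
    rfl
  rw [h1, sqfreeCoeff_def, MvPolynomial.coeff_monomial]
  congr 1
  have h2 : ∀ v, (∑ i, Finsupp.single (e i) 1 : V →₀ ℕ) v = #{i | e i = v} := fun v => by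
    rw [Finsupp.finsetSum_apply, card_filter]
    exact sum_congr rfl fun i _ => by simp [Finsupp.single_apply]
  rw [Finsupp.ext_iff, Function.bijective_iff_existsUnique]
  simp only [h2, sqfreeExp_apply, mem_univ, if_true, eq_iff_iff, card_eq_one,
    Finset.ext_iff, mem_filter, true_and, mem_singleton]
  exact forall_congr' fun a => exists_congr fun i =>
    ⟨fun h => ⟨(h i).mpr rfl, fun j hj => (h j).mp hj⟩, fun h j => ⟨h.2 j, fun e => e ▸ h.1⟩⟩

lemma chainSeries_expand (t : V → K) (col : V → ℕ) (l : List ℕ) (z : K) :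
    chainSeries Y t col l z = ∑ e : Fin l.length → V, if ∀ i, col (e i) = l.get i then
      MvPolynomial.C (algebraMap K Y (chainWeight z ((List.ofFn e).map t))) *
        ∏ i, MvPolynomial.X (e i) else 0 := by
  induction l generalizing z with
  | nil => simp [chainSeries, chainWeight]
  | cons a l ih =>
    rw [chainSeries]
    refine Eq.trans ?_ ((Fin.consEquiv (n := l.length) fun _ => V).sum_comp _)
    rw [Fintype.sum_prod_type]
    refine sum_congr rfl fun v _ => ?_
    split_ifs with h
    · rw [ih, mul_sum, mul_sum]
      refine sum_congr rfl fun e _ => ?_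
      have hc : (∀ i : Fin (l.length + 1), col ((Fin.cons v e : Fin (l.length + 1) → V) i) =
          (a :: l).get i) ↔ ∀ i, col (e i) = l.get i := by
        rw [Fin.forall_fin_succ]
        simp [h]
      refine Eq.trans ?_ (if_congr hc rfl rfl).symm
      split_ifs
      · change _ = MvPolynomial.C (algebraMap K Y (chainWeight z
          ((List.ofFn (Fin.cons v e : Fin (l.length + 1) → V)).map t))) *
          ∏ i, MvPolynomial.X ((Fin.cons v e : Fin (l.length + 1) → V) i)
        rw [Fin.prod_univ_succ, List.ofFn_succ]
        simp only [Fin.cons_zero, Fin.cons_succ, List.map_cons, chainWeight, map_mul]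
        ring
      · simp
    · symm
      refine sum_eq_zero fun e _ => if_neg fun h' => h ?_
      simpa using h' 0

/-- The sum of the weights of all ways to fill a collection of `p β` chains of each type `β`
bijectively with the variables. -/
def fillingSum (t : V → K) (col : V → ℕ) (lst : B → List ℕ) (z : K) (p : B → ℕ) : K :=
  ∑ e : ∀ l : (β : B) × Fin (p β), Fin (lst l.1).length → V,
    if (∀ l i, col (e l i) = (lst l.1).get i) ∧
      Function.Bijective fun q : (l : (β : B) × Fin (p β)) × Fin (lst l.1).length => e q.1 q.2
    then ∏ l, chainWeight z ((List.ofFn (e l)).map t) else 0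

lemma sqfreeCoeff_univ_prod_chainSeries (t : V → K) (col : V → ℕ) (lst : B → List ℕ) (z : K)
    (p : B → ℕ) : sqfreeCoeff univ (∏ β, chainSeries Y t col (lst β) z ^ p β) =
      algebraMap K Y (fillingSum t col lst z p) := by
  have h1 : ∏ β, chainSeries Y t col (lst β) z ^ p β =
      ∏ l : (β : B) × Fin (p β), chainSeries Y t col (lst l.1) z := by
    rw [Fintype.prod_sigma]
    simp
  rw [h1]
  simp only [chainSeries_expand]
  rw [prod_univ_sum, Fintype.piFinset_univ, map_sum, fillingSum, map_sum]
  refine sum_congr rfl fun e _ => ?_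
  rw [prod_ite_zero]
  simp only [mem_univ, true_imp_iff]
  by_cases hc : ∀ l i, col (e l i) = (lst l.1).get i
  · rw [if_pos hc, prod_mul_distrib, ← map_prod, ← map_prod, sqfreeCoeff_C_mul,
      ← Fintype.prod_sigma', sqfreeCoeff_univ_prod_X]
    simp only [hc, implies_true, true_and]
    split_ifs <;> simp
  · rw [if_neg hc, if_neg fun h => hc h.1, map_zero, map_zero]

theorem pbwMap_expCoeff_univ [CharZero K] (t : V → K) (col : V → ℕ)
    (hd : B → ℕ) (tl : B → List ℕ) (Fp : (B →₀ ℕ) → Q) (N : ℕ) (z : K) :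
    pbwMap K Fp (expCoeff t col hd tl N z univ) =
      ∑ n ∈ range (N + 1), ∑ p ∈ piAntidiag univ n,
        (((∏ β, (p β).factorial : ℕ) : K)⁻¹ *
          fillingSum t col (fun β => hd β :: tl β) z p) • Fp (Finsupp.equivFunOnFinite.symm p) := by
  rw [expCoeff, map_sum]
  refine sum_congr rfl fun n _ => ?_
  rw [rootSeries, sum_pow_eq_sum_piAntidiag, map_sum, smul_sum, map_sum]
  refine sum_congr rfl fun p hp => ?_
  rw [mem_piAntidiag] at hp
  simp only [mul_pow, prod_mul_distrib, ← map_pow, ← map_prod]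
  rw [← map_natCast (MvPolynomial.C (σ := V)), sqfreeCoeff_C_mul, sqfreeCoeff_C_mul,
    sqfreeCoeff_univ_prod_chainSeries]
  have h1 : ((n.factorial : K)⁻¹ • ((Nat.multinomial univ p : MvPolynomial B K) *
      ((∏ β, MvPolynomial.X β ^ p β) * algebraMap K (MvPolynomial B K)
        (fillingSum t col (fun β => hd β :: tl β) z p)))) =
      MvPolynomial.monomial (Finsupp.equivFunOnFinite.symm p)
        (((∏ β, (p β).factorial : ℕ) : K)⁻¹ * fillingSum t col (fun β => hd β :: tl β) z p) := by
    have h2 : (Nat.multinomial univ p : K) = (n.factorial : K) *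
        ((∏ β, (p β).factorial : ℕ) : K)⁻¹ := by
      have h3 := Nat.multinomial_spec univ p
      rw [hp.1] at h3
      have h4 : ((∏ β, (p β).factorial : ℕ) : K) ≠ 0 :=
        Nat.cast_ne_zero.mpr (prod_ne_zero_iff.mpr fun β _ => Nat.factorial_ne_zero _)
      rw [← h3, Nat.cast_mul]
      field_simp
    have h5 : (n.factorial : K) ≠ 0 := Nat.cast_ne_zero.mpr (Nat.factorial_ne_zero n)
    rw [MvPolynomial.monomial_eq, Finsupp.prod_fintype _ _ (by simp), Algebra.smul_def,
      ← map_natCast (algebraMap K (MvPolynomial B K)), h2, ← MvPolynomial.algebraMap_eq]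
    simp only [map_mul, Finsupp.equivFunOnFinite_symm_apply_apply]
    have h6 : algebraMap K (MvPolynomial B K) (n.factorial : K)⁻¹ *
        algebraMap K (MvPolynomial B K) (n.factorial : K) = 1 := by
      rw [← map_mul, inv_mul_cancel₀ h5, map_one]
    linear_combination (algebraMap K (MvPolynomial B K)
      ((∏ β, (p β).factorial : ℕ) : K)⁻¹ * ((∏ β, MvPolynomial.X β ^ p β) *
        algebraMap K (MvPolynomial B K) (fillingSum t col (fun β => hd β :: tl β) z p))) * h6
  rw [h1, pbwMap_monomial]

end Expansion

section ChainBracket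

variable {L : Type*} [LieRing L]

/-- The iterated bracket `[x_{c+m}, [x_{c+m-1}, […, x_c]…]]`. -/
def chainBracket (x : ℕ → L) (c : ℕ) : ℕ → L
  | 0 => x c
  | m + 1 => ⁅x (c + m + 1), chainBracket x c m⁆

/-- The Serre relations of a linear Dynkin diagram. -/
structure IsSerreChain (x : ℕ → L) : Prop where
  comm : ∀ i j, i + 2 ≤ j → ⁅x j, x i⁆ = 0
  up : ∀ i, ⁅x i, ⁅x i, x (i + 1)⁆⁆ = 0
  down : ∀ i, ⁅x (i + 1), ⁅x (i + 1), x i⁆⁆ = 0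

namespace IsSerreChain

variable {x : ℕ → L} (hx : IsSerreChain x)

include hx

lemma comm' (i j : ℕ) (h : i + 2 ≤ j) : ⁅x i, x j⁆ = 0 := by
  rw [← lie_skew, hx.comm i j h, neg_zero]

lemma lie_chainBracket_far (a c m : ℕ) (h : c + m + 2 ≤ a ∨ a + 2 ≤ c) :
    ⁅x a, chainBracket x c m⁆ = 0 := by
  induction m with
  | zero =>
    rcases h with h | h
    · exact hx.comm _ _ (by omega)
    · exact hx.comm' _ _ (by omega)
  | succ m ih =>
    rw [chainBracket, leibniz_lie, ih (by omega), lie_zero, add_zero]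
    rcases h with h | h
    · rw [hx.comm _ _ (by omega), zero_lie]
    · rw [hx.comm' _ _ (by omega), zero_lie]

lemma chainBracket_lie_pred (a m : ℕ) :
    ⁅chainBracket x (a + 1) m, x a⁆ = chainBracket x a (m + 1) := by
  induction m with
  | zero => rfl
  | succ m ih =>
    rw [chainBracket, lie_lie, ih, hx.comm _ _ (by omega), lie_zero, sub_zero,
      chainBracket.eq_2 x a (m + 1)]
    congr 2
    omega

lemma chainBracket_lie_self (a m : ℕ) : ⁅chainBracket x a m, x a⁆ = 0 := by
  induction m with
  | zero => exact lie_self _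
  | succ m ih =>
    rw [chainBracket, lie_lie, ih, lie_zero, zero_sub, neg_eq_zero]
    rcases m with _ | m
    · change ⁅x a, ⁅x (a + 1), x a⁆⁆ = 0
      rw [← lie_skew (x (a + 1)) (x a), lie_neg, hx.up, neg_zero]
    · rw [hx.comm _ _ (by omega), lie_zero]

lemma lie_chainBracket_top (c m : ℕ) : ⁅x (c + m + 1), chainBracket x c (m + 1)⁆ = 0 := by
  rcases m with _ | m
  · exact hx.down c
  · have h1 := hx.lie_chainBracket_far (c + (m + 1) + 1) c m (by omega)
    rw [chainBracket, chainBracket, leibniz_lie (x (c + (m + 1) + 1)) (x (c + m + 1)), h1,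
      lie_zero, add_zero, leibniz_lie, h1, lie_zero, add_zero, ← add_assoc, hx.down, zero_lie]

lemma lie_chainBracket_middle (h2 : ∀ y : L, y + y = 0 → y = 0) (c m n : ℕ) :
    ⁅x (c + m + 1), chainBracket x c (m + 2 + n)⁆ = 0 := by
  induction n with
  | zero =>
    rw [add_zero, chainBracket, chainBracket]
    set y := chainBracket x c m
    set a := c + m + 1
    have ha : c + (m + 1) + 1 = a + 1 := by omega
    rw [ha]
    have e1 : ⁅x (a + 1), y⁆ = 0 := hx.lie_chainBracket_far _ _ _ (by omega)
    have e2 : ⁅x a, ⁅x a, y⁆⁆ = 0 := hx.lie_chainBracket_top c m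
    have e3 : ⁅⁅x a, x (a + 1)⁆, y⁆ = -⁅x (a + 1), ⁅x a, y⁆⁆ := by
      rw [lie_lie, e1, lie_zero, zero_sub]
    have e4 : ⁅x a, ⁅x (a + 1), ⁅x a, y⁆⁆⁆ = ⁅⁅x a, x (a + 1)⁆, ⁅x a, y⁆⁆ := by
      rw [leibniz_lie, e2, lie_zero, add_zero]
    have e5 : ⁅⁅x a, x (a + 1)⁆, ⁅x a, y⁆⁆ = -⁅x a, ⁅x (a + 1), ⁅x a, y⁆⁆⁆ := by
      rw [leibniz_lie, ← lie_skew ⁅x a, x (a + 1)⁆ (x a), hx.up, neg_zero, zero_lie, zero_add, e3, lie_neg]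
    refine h2 _ ?_
    nth_rw 1 [e4]
    rw [e5, neg_add_cancel]
  | succ n ih =>
    rw [← add_assoc, chainBracket, leibniz_lie, ih, lie_zero, add_zero, hx.comm' _ _ (by omega),
      zero_lie]

lemma chainBracket_lie_succ (h2 : ∀ y : L, y + y = 0 → y = 0) (a m : ℕ) :
    ⁅chainBracket x (a + 1) m, chainBracket x a (m + 1)⁆ = 0 := by
  induction m with
  | zero => exact hx.down a
  | succ m ih =>
    have ha : a + 1 + m + 1 = a + (m + 1) + 1 := by omega
    set d := x (a + (m + 1) + 1) with hd
    have e1 : ⁅d, chainBracket x (a + 1) (m + 1)⁆ = 0 := by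
      have := hx.lie_chainBracket_top (a + 1) m
      rwa [ha] at this
    have e2 : ⁅d, chainBracket x a (m + 1 + 1)⁆ = 0 := hx.lie_chainBracket_top a (m + 1)
    have f1 : ⁅d, chainBracket x (a + 1) m⁆ = chainBracket x (a + 1) (m + 1) := by
      rw [chainBracket, ha]
    have f2 : ⁅d, chainBracket x a (m + 1)⁆ = chainBracket x a (m + 1 + 1) := rfl
    have g1 : ⁅chainBracket x (a + 1) (m + 1), chainBracket x a (m + 1)⁆ +
        ⁅chainBracket x (a + 1) m, chainBracket x a (m + 1 + 1)⁆ = 0 := by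
      rw [← f1, ← f2, ← leibniz_lie, ih, lie_zero]
    have g2 := congrArg (fun y => ⁅d, y⁆) g1
    simp only [lie_add, lie_zero] at g2
    rw [leibniz_lie, leibniz_lie d (chainBracket x (a + 1) m), e1, e2, f1, f2] at g2
    simp only [zero_lie, lie_zero, zero_add, add_zero] at g2
    exact h2 _ g2

lemma chainBracket_lie_same_top (h2 : ∀ y : L, y + y = 0 → y = 0) (a m n : ℕ) :
    ⁅chainBracket x (a + n) m, chainBracket x a (m + n)⁆ = 0 := by
  induction n generalizing a with
  | zero => exact lie_self _
  | succ n ih =>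
    rcases n with _ | n
    · exact hx.chainBracket_lie_succ h2 a m
    · have h := ih (a + 1)
      have e : a + 1 + (n + 1) = a + (n + 1 + 1) := by omega
      rw [e] at h
      rw [← add_assoc m, ← hx.chainBracket_lie_pred, leibniz_lie, h, zero_lie, zero_add,
        ← lie_skew (chainBracket x (a + (n + 1 + 1)) m) (x a),
        hx.lie_chainBracket_far a (a + (n + 1 + 1)) m (by omega), neg_zero, lie_zero]

end IsSerreChain

end ChainBracket

section PBWWord

variable {B Q : Type*} [Ring Q]

/-- The ordered product of the `F β ^ p β` over a list. -/
def pbwWord (F : B → Q) (L : List B) (p : B →₀ ℕ) : Q := (L.map fun β => F β ^ p β).prod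

/-- The change of exponents when one box is added at the bottom of a root of type `rest β`. -/
def pbwStep (rest : B → Option B) (β : B) (p : B →₀ ℕ) : B →₀ ℕ :=
  match rest β with
  | none => p + Finsupp.single β 1
  | some b => p - Finsupp.single b 1 + Finsupp.single β 1

/-- The multiplicity with which the change of exponents `pbwStep` occurs. -/
def pbwMult (rest : B → Option B) (β : B) (p : B →₀ ℕ) : ℕ :=
  match rest β with
  | none => 1
  | some b => p b

/-- The sum over the roots in `M` satisfying `hs` of the modified words over `L`. -/
def headSum (F : B → Q) (rest : B → Option B) (hs : B → Prop) (M L : List B) (p : B →₀ ℕ) : Q :=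
  (M.map fun β => if hs β then pbwMult rest β p • pbwWord F L (pbwStep rest β p) else 0).sum

variable (F : B → Q) (rest : B → Option B) (hs : B → Prop)

lemma pbwWord_append (L M : List B) (p : B →₀ ℕ) :
    pbwWord F (L ++ M) p = pbwWord F L p * pbwWord F M p := by simp [pbwWord]

lemma pbwWord_congr (L : List B) (p q : B →₀ ℕ) (h : ∀ γ ∈ L, p γ = q γ) :
    pbwWord F L p = pbwWord F L q := by
  rw [pbwWord, pbwWord, List.map_congr_left fun γ hγ => by rw [h γ hγ]]

lemma pbwStep_apply (β γ : B) (p : B →₀ ℕ) (h : β ≠ γ) (h' : rest β ≠ some γ) :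
    pbwStep rest β p γ = p γ := by
  rw [pbwStep]
  rcases hr : rest β with _ | b
  · simp [h]
  · have : b ≠ γ := fun e => h' (by rw [hr, e])
    simp [h, this]

/-- The roots of `M` satisfying `hs`, together with their rests, are not in `L`. -/
def HeadsAvoid (M L : List B) : Prop :=
  ∀ β ∈ M, hs β → ∀ γ ∈ L, β ≠ γ ∧ rest β ≠ some γ

lemma headSum_append (M M' L : List B) (p : B →₀ ℕ) :
    headSum F rest hs (M ++ M') L p = headSum F rest hs M L p + headSum F rest hs M' L p := by
  simp [headSum]

lemma headSum_append_right (M L L' : List B) (p : B →₀ ℕ) (h : HeadsAvoid rest hs M L') :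
    headSum F rest hs M (L ++ L') p = headSum F rest hs M L p * pbwWord F L' p := by
  rw [headSum, headSum, ← List.sum_map_mul_right]
  congr 1
  refine List.map_congr_left fun β hβ => ?_
  split_ifs with hsβ
  · rw [pbwWord_append, smul_mul_assoc, pbwWord_congr F L' (pbwStep rest β p) p fun γ hγ =>
      pbwStep_apply rest β γ p (h β hβ hsβ γ hγ).1 (h β hβ hsβ γ hγ).2]
  · rw [zero_mul]

lemma headSum_append_left (M L L' : List B) (p : B →₀ ℕ) (h : HeadsAvoid rest hs M L') :
    headSum F rest hs M (L' ++ L) p = pbwWord F L' p * headSum F rest hs M L p := by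
  rw [headSum, headSum, ← List.sum_map_mul_left]
  congr 1
  refine List.map_congr_left fun β hβ => ?_
  split_ifs with hsβ
  · rw [pbwWord_append, mul_smul_comm, pbwWord_congr F L' (pbwStep rest β p) p fun γ hγ =>
      pbwStep_apply rest β γ p (h β hβ hsβ γ hγ).1 (h β hβ hsβ γ hγ).2]
  · rw [mul_zero]

lemma pbwWord_append_mul (f y : Q) (L M : List B) (p : B →₀ ℕ)
    (h1 : HeadsAvoid rest hs L M) (h2 : HeadsAvoid rest hs M L)
    (hL : pbwWord F L p * f = y * pbwWord F L p + headSum F rest hs L L p)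
    (hM : pbwWord F M p * f = f * pbwWord F M p + headSum F rest hs M M p) :
    pbwWord F (L ++ M) p * f =
      y * pbwWord F (L ++ M) p + headSum F rest hs (L ++ M) (L ++ M) p := by
  rw [pbwWord_append, mul_assoc, hM, mul_add, ← mul_assoc, hL, headSum_append,
    headSum_append_right _ _ _ _ _ _ _ h1, headSum_append_left _ _ _ _ _ _ _ h2]
  noncomm_ring

lemma pbwWord_append_mul_of_absorb (f : Q) (L M : List B) (p : B →₀ ℕ)
    (h1 : ∀ β ∈ L, ¬ hs β) (h2 : HeadsAvoid rest hs M L)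
    (hM : pbwWord F M p * f = headSum F rest hs M M p) :
    pbwWord F (L ++ M) p * f = headSum F rest hs (L ++ M) (L ++ M) p := by
  have h0 : headSum F rest hs L (L ++ M) p = 0 := by
    rw [headSum, List.map_congr_left fun β hβ => if_neg (h1 β hβ)]
    simp
  rw [pbwWord_append, mul_assoc, hM, headSum_append, h0, zero_add,
    headSum_append_left _ _ _ _ _ _ _ h2]

lemma mul_pbwWord_of_commute (L : List B) (hL : L.Nodup) (β : B) (hβ : β ∈ L) (p : B →₀ ℕ)
    (hc : ∀ γ ∈ L, Commute (F β) (F γ)) :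
    F β * pbwWord F L p = pbwWord F L (p + Finsupp.single β 1) := by
  obtain ⟨X, W, rfl⟩ := List.append_of_mem hβ
  rw [List.nodup_append] at hL
  have hX : Commute (F β) (pbwWord F X p) :=
    Commute.list_prod_right _ _ fun y hy => by
      obtain ⟨γ, hγ, rfl⟩ := List.mem_map.mp hy
      exact (hc γ (by simp [hγ])).pow_right _
  have e1 : pbwWord F X (p + Finsupp.single β 1) = pbwWord F X p :=
    pbwWord_congr _ _ _ _ fun γ hγ => by
      have : β ≠ γ := fun e => hL.2.2 γ hγ β (by simp) e.symm
      simp [this]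
  have e2 : pbwWord F (β :: W) (p + Finsupp.single β 1) = F β * pbwWord F (β :: W) p := by
    have : pbwWord F W (p + Finsupp.single β 1) = pbwWord F W p :=
      pbwWord_congr _ _ _ _ fun γ hγ => by
        have : β ≠ γ := fun e => (List.nodup_cons.mp hL.2.1).1 (e ▸ hγ)
        simp [this]
    rw [pbwWord] at this ⊢
    rw [List.map_cons, List.prod_cons, this]
    simp [pbwWord, pow_succ', mul_assoc]
  rw [pbwWord_append, pbwWord_append, e1, e2, ← mul_assoc, hX.eq, mul_assoc]

lemma pow_mul_of_commutator {a b f : Q} (h : b * f = f * b + a) (hab : Commute a b) (n : ℕ) :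
    b ^ n * f = f * b ^ n + n • (a * b ^ (n - 1)) := by
  induction n with
  | zero => simp
  | succ n ih =>
    have e : n • (b * (a * b ^ (n - 1))) = n • (a * b ^ n) := by
      rcases n with _ | n
      · simp
      · rw [← mul_assoc, ← hab.eq, mul_assoc, Nat.add_sub_cancel, ← pow_succ']
    rw [pow_succ', mul_assoc, ih, mul_add, ← mul_assoc, h, mul_smul_comm, e, add_mul,
      Nat.add_sub_cancel, succ_nsmul, mul_assoc]
    abel

lemma pbwWord_mul_of_derivation (L : List B) (hL : L.Nodup) (β b : B) (hβ : β ∈ L) (hb : b ∈ L)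
    (f : Q) (hf : ∀ γ ∈ L, γ ≠ b → Commute f (F γ))
    (hfb : F b * f = f * F b + F β) (hc : ∀ γ ∈ L, Commute (F β) (F γ)) (p : B →₀ ℕ) :
    pbwWord F L p * f = f * pbwWord F L p +
      p b • pbwWord F L (p - Finsupp.single b 1 + Finsupp.single β 1) := by
  rw [← mul_pbwWord_of_commute F L hL β hβ _ hc]
  obtain ⟨X, W, rfl⟩ := List.append_of_mem hb
  rw [List.nodup_append] at hL
  have hbX : ∀ γ ∈ X, γ ≠ b := fun γ hγ => hL.2.2 γ hγ b (by simp)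
  have hbW : ∀ γ ∈ W, γ ≠ b := fun γ hγ e => (List.nodup_cons.mp hL.2.1).1 (e ▸ hγ)
  have hX : Commute (F β) (pbwWord F X p) :=
    Commute.list_prod_right _ _ fun y hy => by
      obtain ⟨γ, hγ, rfl⟩ := List.mem_map.mp hy
      exact (hc γ (by simp [hγ])).pow_right _
  have hfX : Commute f (pbwWord F X p) :=
    Commute.list_prod_right _ _ fun y hy => by
      obtain ⟨γ, hγ, rfl⟩ := List.mem_map.mp hy
      exact (hf γ (by simp [hγ]) (hbX γ hγ)).pow_right _
  have hfW : Commute f (pbwWord F W p) :=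
    Commute.list_prod_right _ _ fun y hy => by
      obtain ⟨γ, hγ, rfl⟩ := List.mem_map.mp hy
      exact (hf γ (by simp [hγ]) (hbW γ hγ)).pow_right _
  have hs : ∀ M : List B, (∀ γ ∈ M, γ ≠ b) →
      pbwWord F M (p - Finsupp.single b 1) = pbwWord F M p := fun M hM =>
    pbwWord_congr _ _ _ _ fun γ hγ => by simp [(hM γ hγ).symm]
  have hcons : ∀ q : B →₀ ℕ, pbwWord F (b :: W) q = F b ^ q b * pbwWord F W q := fun q => by
    simp [pbwWord]
  rw [pbwWord_append, pbwWord_append, hcons, hcons, hs X hbX, hs W hbW]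
  have hpb : (p - Finsupp.single b 1 : B →₀ ℕ) b = p b - 1 := by simp
  rw [hpb]
  have key := pow_mul_of_commutator hfb (hc b hb) (p b)
  calc pbwWord F X p * (F b ^ p b * pbwWord F W p) * f
      = pbwWord F X p * (F b ^ p b * f) * pbwWord F W p := by
        rw [mul_assoc, mul_assoc, ← hfW.eq]
        simp only [mul_assoc]
    _ = f * (pbwWord F X p * (F b ^ p b * pbwWord F W p)) + p b • (F β *
        (pbwWord F X p * (F b ^ (p b - 1) * pbwWord F W p))) := by
        rw [key, mul_add, add_mul, mul_smul_comm, smul_mul_assoc]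
        congr 1
        · rw [← mul_assoc, ← hfX.eq]; simp only [mul_assoc]
        · rw [← mul_assoc, ← hX.eq]; simp only [mul_assoc]

end PBWWord

section RootCombinatorics

variable (r : ℕ)

/-- The first color of the chain of a root. -/
def headD (β : RootD r) : ℕ :=
  match β with
  | .inl q => (q.1.1 : ℕ) + 1
  | .inr _ => 0

/-- The root obtained from `β` by removing its first color. -/
def restD (β : RootD r) : Option (RootD r) :=
  match β with
  | .inl q => if h : (q.1.1 : ℕ) + 1 < q.1.2 then
      some (.inl ⟨(⟨(q.1.1 : ℕ) + 1, h.trans q.1.2.2⟩, q.1.2), h⟩) else none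
  | .inr v => if h : 1 < (v : ℕ) then
      some (.inl ⟨(⟨1, h.trans v.1.2⟩, v.1), h⟩) else none

/-- The colors of the chain of a root, except for the first. -/
def tailD (β : RootD r) : List ℕ :=
  List.range' (max 1 (headD r β) + 1) (jIdxD r β - 1 - max 1 (headD r β))

variable {r}

lemma max_headD_lt (β : RootD r) : max 1 (headD r β) < jIdxD r β := by
  rcases β with ⟨⟨i, j⟩, h⟩ | ⟨v, h⟩
  · have : (i : ℕ) < j := h
    simp only [headD, jIdxD]
    omega
  · simp only [headD, jIdxD]
    omega

lemma jIdxD_le (β : RootD r) : jIdxD r β ≤ r := by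
  rcases β with ⟨⟨i, j⟩, h⟩ | ⟨v, h⟩
  · exact j.2
  · exact v.2

lemma rootD_ext {β γ : RootD r} (h1 : headD r β = headD r γ) (h2 : jIdxD r β = jIdxD r γ) :
    β = γ := by
  rcases β with ⟨⟨i, j⟩, h⟩ | ⟨v, h⟩ <;> rcases γ with ⟨⟨i', j'⟩, h'⟩ | ⟨v', h'⟩ <;>
    simp only [headD, jIdxD, Nat.add_right_cancel_iff, Fin.val_inj, reduceCtorEq] at h1 h2
  · subst h1 h2; rfl
  · subst h2; rfl

lemma exists_rootD (a d : ℕ) (hd : d < r) (h : max 1 a ≤ d) :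
    ∃ β : RootD r, headD r β = a ∧ jIdxD r β = d + 1 := by
  rcases a with _ | a
  · exact ⟨.inr ⟨⟨d, hd⟩, by show 0 < d; omega⟩, rfl, rfl⟩
  · exact ⟨.inl ⟨(⟨a, by omega⟩, ⟨d, hd⟩), Fin.mk_lt_mk.mpr (by omega)⟩, rfl, rfl⟩

lemma restD_eq_some {β γ : RootD r} (h : restD r β = some γ) :
    headD r γ = max 1 (headD r β) + 1 ∧ jIdxD r γ = jIdxD r β := by
  rcases β with ⟨⟨i, j⟩, hij⟩ | ⟨v, hv⟩
  · simp only [restD] at h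
    split_ifs at h
    cases h
    simp [headD, jIdxD]
  · simp only [restD] at h
    split_ifs at h
    cases h
    simp [headD, jIdxD]

lemma restD_eq_none {β : RootD r} (h : restD r β = none) :
    jIdxD r β = max 1 (headD r β) + 1 := by
  rcases β with ⟨⟨i, j⟩, hij⟩ | ⟨v, hv⟩
  · have : (i : ℕ) < j := hij
    simp only [restD] at h
    split_ifs at h
    simp only [headD, jIdxD]
    omega
  · simp only [restD] at h
    split_ifs at h
    simp only [headD, jIdxD]
    omega

lemma tailD_eq (β : RootD r) :
    tailD r β = match restD r β with
      | none => []
      | some b => headD r b :: tailD r b := by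
  rcases h : restD r β with _ | γ
  · have := restD_eq_none h
    simp only [tailD, List.range'_eq_nil_iff]
    omega
  · obtain ⟨h1, h2⟩ := restD_eq_some h
    have h3 := max_headD_lt γ
    simp only [tailD, h1, h2] at h3 ⊢
    have e1 : max 1 (max 1 (headD r β) + 1) = max 1 (headD r β) + 1 := by omega
    rw [e1] at h3 ⊢
    have e2 : jIdxD r β - 1 - max 1 (headD r β) =
      (jIdxD r β - 1 - (max 1 (headD r β) + 1)) + 1 := by omega
    rw [e2, List.range'_succ]

/-- The root `ε_1 + ε_{j+1}` as a list with at most one element. -/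
def plusListD (r j : ℕ) : List (RootD r) :=
  if h : j < r ∧ 0 < j then [.inr ⟨⟨j, h.1⟩, h.2⟩] else []

/-- The root `ε_{j+1} - ε_{i+1}` as a list with at most one element. -/
def minusListD (r i j : ℕ) : List (RootD r) :=
  if h : i < r ∧ j < r ∧ i < j then
    [.inl ⟨(⟨i, h.1⟩, ⟨j, h.2.1⟩), by exact Fin.mk_lt_mk.mpr h.2.2⟩] else []

/-- The chain roots with second index `j + 1`, in increasing order. -/
def blockD (r j : ℕ) : List (RootD r) :=
  plusListD r j ++ (List.range j).flatMap fun i => minusListD r i j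

/-- All chain roots, in increasing order. -/
def enumD (r : ℕ) : List (RootD r) := (List.range' 1 (r - 1)).flatMap (blockD r)

lemma mem_plusListD {j : ℕ} {β : RootD r} :
    β ∈ plusListD r j ↔ headD r β = 0 ∧ jIdxD r β = j + 1 := by
  rw [plusListD]
  split_ifs with h
  · rw [List.mem_singleton]
    exact ⟨fun e => by subst e; exact ⟨rfl, rfl⟩, fun e => rootD_ext e.1 e.2⟩
  · have h1 := max_headD_lt β
    have h2 := jIdxD_le β
    simp only [List.not_mem_nil, false_iff]
    omega

lemma mem_minusListD {i j : ℕ} {β : RootD r} :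
    β ∈ minusListD r i j ↔ headD r β = i + 1 ∧ jIdxD r β = j + 1 := by
  rw [minusListD]
  split_ifs with h
  · rw [List.mem_singleton]
    exact ⟨fun e => by subst e; exact ⟨rfl, rfl⟩, fun e => rootD_ext e.1 e.2⟩
  · have h1 := max_headD_lt β
    have h2 := jIdxD_le β
    simp only [List.not_mem_nil, false_iff]
    omega

lemma mem_blockD {j : ℕ} {β : RootD r} : β ∈ blockD r j ↔ jIdxD r β = j + 1 := by
  simp only [blockD, List.mem_append, List.mem_flatMap, List.mem_range, mem_plusListD,
    mem_minusListD]
  have h1 := max_headD_lt β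
  constructor
  · rintro (h | ⟨i, _, h⟩) <;> exact h.2
  · intro h
    by_cases h0 : headD r β = 0
    · exact Or.inl ⟨h0, h⟩
    · exact Or.inr ⟨headD r β - 1, by omega, by omega, h⟩

lemma mem_enumD (β : RootD r) : β ∈ enumD r := by
  have h1 := max_headD_lt β
  have h2 := jIdxD_le β
  simp only [enumD, List.mem_flatMap, List.mem_range'_1, mem_blockD]
  exact ⟨jIdxD r β - 1, by omega, by omega⟩

lemma nodup_blockD (j : ℕ) : (blockD r j).Nodup := by
  rw [blockD, List.nodup_append]
  refine ⟨?_, ?_, ?_⟩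
  · rw [plusListD]; split_ifs <;> simp
  · rw [List.nodup_flatMap]
    refine ⟨fun i _ => by rw [minusListD]; split_ifs <;> simp, ?_⟩
    refine List.nodup_range.imp fun {i i'} hne β hβ hβ' => hne ?_
    have h1 := (mem_minusListD.mp hβ).1
    have h2 := (mem_minusListD.mp hβ').1
    omega
  · rintro β hβ γ hγ rfl
    obtain ⟨i, _, h⟩ := List.mem_flatMap.mp hγ
    have h1 := (mem_minusListD.mp h).1
    have h2 := (mem_plusListD.mp hβ).1
    omega

lemma nodup_enumD : (enumD r).Nodup := by
  rw [enumD, List.nodup_flatMap]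
  refine ⟨fun j _ => nodup_blockD j, ?_⟩
  refine (List.nodup_range' (n := r - 1)).imp fun {j j'} hne β hβ hβ' => hne ?_
  have h1 := mem_blockD.mp hβ
  have h2 := mem_blockD.mp hβ'
  omega

end RootCombinatorics

section RootVectors

attribute [local instance] LieRing.ofAssociativeRing

variable {r : ℕ} {Q : Type*} [Ring Q] {x : ℕ → Q}

/-- The root vectors, where the roots through the color `b ≤ 1` are sent to zero. -/
def rootVec (x : ℕ → Q) (b : ℕ) (β : RootD r) : Q :=
  if headD r β = b then 0
  else chainBracket x (max 1 (headD r β)) (jIdxD r β - 1 - max 1 (headD r β))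

lemma commute_iff_lie_eq_zero {y z : Q} : Commute y z ↔ ⁅y, z⁆ = 0 := by
  rw [Ring.lie_def, sub_eq_zero]; rfl

lemma commute_rootVec (hx : IsSerreChain x) (h2 : ∀ y : Q, y + y = 0 → y = 0) (b : ℕ)
    (β γ : RootD r) (h : jIdxD r β = jIdxD r γ) : Commute (rootVec x b β) (rootVec x b γ) := by
  wlog hle : max 1 (headD r γ) ≤ max 1 (headD r β) generalizing β γ
  · exact (this γ β h.symm (by omega)).symm
  rw [rootVec, rootVec]
  split_ifs
  · exact Commute.zero_left _
  · exact Commute.zero_left _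
  · exact Commute.zero_right _
  · have h1 := max_headD_lt β
    obtain ⟨n, hn⟩ := Nat.exists_eq_add_of_le hle
    have h3 := hx.chainBracket_lie_same_top h2 (max 1 (headD r γ))
      (jIdxD r β - 1 - max 1 (headD r β)) n
    rw [← hn] at h3
    rw [commute_iff_lie_eq_zero, ← h]
    have e : jIdxD r β - 1 - max 1 (headD r γ) = jIdxD r β - 1 - max 1 (headD r β) + n := by omega
    rw [e]
    exact h3

lemma commute_chain_rootVec (hx : IsSerreChain x) (h2 : ∀ y : Q, y + y = 0 → y = 0) (b α : ℕ)
    (γ : RootD r) (h : α + 1 < jIdxD r γ) (hne : headD r γ ≠ α + 1) (hα : 1 ≤ α) :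
    Commute (x α) (rootVec x b γ) := by
  rw [rootVec]
  split_ifs
  · exact Commute.zero_right _
  · have h1 := max_headD_lt γ
    rw [commute_iff_lie_eq_zero]
    set c := max 1 (headD r γ)
    rcases lt_trichotomy c α with hc | hc | hc
    · obtain ⟨m, rfl⟩ := Nat.exists_eq_add_of_lt hc
      obtain ⟨n, hn⟩ : ∃ n, jIdxD r γ - 1 - c = m + 2 + n :=
        ⟨jIdxD r γ - 1 - c - (m + 2), by omega⟩
      rw [hn]
      exact hx.lie_chainBracket_middle h2 c m n
    · rw [← commute_iff_lie_eq_zero]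
      apply Commute.symm
      rw [commute_iff_lie_eq_zero, ← hc]
      exact hx.chainBracket_lie_self _ _
    · exact hx.lie_chainBracket_far _ _ _ (by omega)

lemma headSum_eq_single {B : Type*} (F : B → Q) (rest : B → Option B) (hs : B → Prop)
    (L M : List B) (hL : L.Nodup) (p : B →₀ ℕ) (β : B) (hβ : β ∈ L)
    (h : ∀ γ ∈ L, hs γ ↔ γ = β) : headSum F rest hs L M p =
      pbwMult rest β p • pbwWord F M (pbwStep rest β p) := by
  rw [headSum, ← List.sum_toFinset _ hL, sum_eq_single β]
  · rw [if_pos ((h β hβ).mpr rfl)]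
  · intro γ hγ hne
    exact if_neg fun h' => hne ((h γ (List.mem_toFinset.mp hγ)).mp h')
  · intro h'
    exact absurd (List.mem_toFinset.mpr hβ) h'

lemma blockD_mul_of_lt (hx : IsSerreChain x) (h2 : ∀ y : Q, y + y = 0 → y = 0) (b a d : ℕ)
    (hab : a ≠ b) (hb : b ≤ 1) (hd : d < r) (had : max 1 a < d) (p : RootD r →₀ ℕ) :
    pbwWord (rootVec x b) (blockD r d) p * x (max 1 a) =
      x (max 1 a) * pbwWord (rootVec x b) (blockD r d) p +
        headSum (rootVec x b) (restD r) (fun β => headD r β = a) (blockD r d) (blockD r d) p := by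
  obtain ⟨β, hβ1, hβ2⟩ := exists_rootD (r := r) a d hd had.le
  have hβ : β ∈ blockD r d := mem_blockD.mpr hβ2
  rw [headSum_eq_single _ _ _ _ _ (nodup_blockD d) p β hβ fun γ hγ =>
    ⟨fun h => rootD_ext (h.trans hβ1.symm) ((mem_blockD.mp hγ).trans hβ2.symm),
      fun h => h ▸ hβ1⟩]
  rcases h : restD r β with _ | β'
  · have := restD_eq_none h
    omega
  obtain ⟨h1, h3⟩ := restD_eq_some h
  have hβ' : β' ∈ blockD r d := mem_blockD.mpr (h3.trans hβ2)
  rw [hβ1] at h1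
  have key := pbwWord_mul_of_derivation (rootVec x b) (blockD r d) (nodup_blockD d) β β' hβ hβ'
    (x (max 1 a)) (fun γ hγ hne => commute_chain_rootVec hx h2 b _ γ
      (by rw [mem_blockD.mp hγ]; omega)
      (fun e => hne (rootD_ext (e.trans h1.symm) (by rw [mem_blockD.mp hγ, mem_blockD.mp hβ'])))
      (by omega)) ?_
    (fun γ hγ => commute_rootVec hx h2 b β γ (by rw [mem_blockD.mp hγ, mem_blockD.mp hβ])) p
  · rw [key]
    simp only [pbwMult, pbwStep, h]
  · have e := hx.chainBracket_lie_pred (max 1 a) (d - max 1 a - 1)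
    rw [Ring.lie_def, sub_eq_iff_eq_add'] at e
    rw [rootVec, rootVec, if_neg (by omega), if_neg (by omega), h1, hβ1, h3, hβ2,
      max_eq_right (by omega : 1 ≤ max 1 a + 1)]
    have e1 : d + 1 - 1 - (max 1 a + 1) = d - max 1 a - 1 := by omega
    have e2 : d + 1 - 1 - max 1 a = d - max 1 a - 1 + 1 := by omega
    rw [e1, e2]
    exact e

lemma blockD_mul_of_eq (hx : IsSerreChain x) (h2 : ∀ y : Q, y + y = 0 → y = 0) (b a : ℕ)
    (hab : a ≠ b) (ha : max 1 a < r) (p : RootD r →₀ ℕ) :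
    pbwWord (rootVec x b) (blockD r (max 1 a)) p * x (max 1 a) =
      headSum (rootVec x b) (restD r) (fun β => headD r β = a) (blockD r (max 1 a))
        (blockD r (max 1 a)) p := by
  obtain ⟨β, hβ1, hβ2⟩ := exists_rootD (r := r) a (max 1 a) ha le_rfl
  have hβ : β ∈ blockD r (max 1 a) := mem_blockD.mpr hβ2
  rw [headSum_eq_single _ _ _ _ _ (nodup_blockD _) p β hβ fun γ hγ =>
    ⟨fun h => rootD_ext (h.trans hβ1.symm) ((mem_blockD.mp hγ).trans hβ2.symm),
      fun h => h ▸ hβ1⟩]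
  have h : restD r β = none := by
    rcases h : restD r β with _ | β'
    · rfl
    · have h1 := restD_eq_some h
      have h3 := max_headD_lt β'
      omega
  have hF : rootVec x b β = x (max 1 a) := by
    rw [rootVec, if_neg (by omega), hβ1, hβ2, Nat.add_sub_cancel, Nat.sub_self]
    rfl
  have hc : ∀ γ ∈ blockD r (max 1 a), Commute (rootVec x b β) (rootVec x b γ) := fun γ hγ =>
    commute_rootVec hx h2 b β γ (by rw [mem_blockD.mp hγ, mem_blockD.mp hβ])
  have hP : Commute (rootVec x b β) (pbwWord (rootVec x b) (blockD r (max 1 a)) p) :=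
    Commute.list_prod_right _ _ fun y hy => by
      obtain ⟨γ, hγ, rfl⟩ := List.mem_map.mp hy
      exact (hc γ hγ).pow_right _
  rw [← hF, ← hP.eq, mul_pbwWord_of_commute _ _ (nodup_blockD _) β hβ p hc]
  simp only [pbwMult, pbwStep, h, one_smul]

lemma headsAvoid_blockD (hs : RootD r → Prop) (M L : List (RootD r))
    (h : ∀ β ∈ M, ∀ γ ∈ L, jIdxD r β ≠ jIdxD r γ) : HeadsAvoid (restD r) hs M L :=
  fun β hβ _ γ hγ => ⟨fun e => h β hβ γ hγ (e ▸ rfl),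
    fun e => h β hβ γ hγ (restD_eq_some e).2.symm⟩

lemma flatMap_blockD_mul (hx : IsSerreChain x) (h2 : ∀ y : Q, y + y = 0 → y = 0) (b a : ℕ)
    (hab : a ≠ b) (hb : b ≤ 1) (p : RootD r →₀ ℕ) (js : List ℕ) (hjs : js.Nodup)
    (hlt : ∀ d ∈ js, max 1 a < d ∧ d < r) :
    pbwWord (rootVec x b) (js.flatMap (blockD r)) p * x (max 1 a) =
      x (max 1 a) * pbwWord (rootVec x b) (js.flatMap (blockD r)) p +
        headSum (rootVec x b) (restD r) (fun β => headD r β = a) (js.flatMap (blockD r))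
          (js.flatMap (blockD r)) p := by
  induction js with
  | nil => simp [pbwWord, headSum]
  | cons d js ih =>
    rw [List.nodup_cons] at hjs
    have hne : ∀ β ∈ blockD r d, ∀ γ ∈ js.flatMap (blockD r), jIdxD r β ≠ jIdxD r γ := by
      intro β hβ γ hγ e
      obtain ⟨d', hd', h⟩ := List.mem_flatMap.mp hγ
      rw [mem_blockD] at hβ h
      have : d = d' := by omega
      exact hjs.1 (this ▸ hd')
    rw [List.flatMap_cons]
    exact pbwWord_append_mul _ _ _ _ _ _ _ _ (headsAvoid_blockD _ _ _ hne)
      (headsAvoid_blockD _ _ _ fun β hβ γ hγ => (hne γ hγ β hβ).symm)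
      (blockD_mul_of_lt hx h2 b a d hab hb (hlt d (by simp)).2 (hlt d (by simp)).1 p)
      (ih hjs.2 fun d' hd' => hlt d' (by simp [hd']))

lemma enumD_mul (hx : IsSerreChain x) (h2 : ∀ y : Q, y + y = 0 → y = 0) (b a : ℕ)
    (hab : a ≠ b) (hb : b ≤ 1) (ha : max 1 a < r) (p : RootD r →₀ ℕ) :
    pbwWord (rootVec x b) (enumD r) p * x (max 1 a) =
      ∑ β, if headD r β = a then
        pbwMult (restD r) β p • pbwWord (rootVec x b) (enumD r) (pbwStep (restD r) β p) else 0 := by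
  have hsum : headSum (rootVec x b) (restD r) (fun β => headD r β = a) (enumD r) (enumD r) p =
      ∑ β, if headD r β = a then
        pbwMult (restD r) β p • pbwWord (rootVec x b) (enumD r) (pbwStep (restD r) β p) else 0 := by
    rw [headSum, ← List.sum_toFinset _ nodup_enumD]
    exact sum_congr (by ext β; simp [mem_enumD]) fun _ _ => by split_ifs <;> rfl
  rw [← hsum]
  obtain ⟨s, t, hst⟩ := List.append_of_mem
    (show max 1 a ∈ List.range' 1 (r - 1) by rw [List.mem_range'_1]; omega)
  have hp : (s ++ max 1 a :: t).Pairwise (· < ·) := hst ▸ List.pairwise_lt_range'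
  have hr : ∀ d ∈ s ++ max 1 a :: t, d < r := fun d hd => by
    rw [← hst, List.mem_range'_1] at hd
    omega
  rw [List.pairwise_append, List.pairwise_cons] at hp
  rw [enumD, hst, List.flatMap_append, List.flatMap_cons]
  have hne : ∀ β ∈ blockD r (max 1 a), ∀ γ ∈ t.flatMap (blockD r), jIdxD r β ≠ jIdxD r γ := by
    intro β hβ γ hγ
    obtain ⟨d, hd, h⟩ := List.mem_flatMap.mp hγ
    rw [mem_blockD] at hβ h
    have := hp.2.1.1 d hd
    omega
  have hne' : ∀ β ∈ blockD r (max 1 a) ++ t.flatMap (blockD r),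
      ∀ γ ∈ s.flatMap (blockD r), jIdxD r β ≠ jIdxD r γ := by
    intro β hβ γ hγ
    obtain ⟨d, hd, h⟩ := List.mem_flatMap.mp hγ
    rw [mem_blockD] at h
    rcases List.mem_append.mp hβ with hβ | hβ
    · rw [mem_blockD] at hβ
      have := hp.2.2 d hd (max 1 a) (by simp)
      omega
    · obtain ⟨d', hd', h'⟩ := List.mem_flatMap.mp hβ
      rw [mem_blockD] at h'
      have := hp.2.2 d hd d' (by simp [hd'])
      omega
  refine pbwWord_append_mul_of_absorb _ _ _ _ _ _ _ ?_ (headsAvoid_blockD _ _ _ hne') ?_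
  · intro β hβ h
    obtain ⟨d, hd, h'⟩ := List.mem_flatMap.mp hβ
    rw [mem_blockD] at h'
    have h1 := hp.2.2 d hd (max 1 a) (by simp)
    have h3 := max_headD_lt β
    omega
  · have := pbwWord_append_mul (rootVec x b) (restD r) (fun β => headD r β = a) (x (max 1 a)) 0
      (blockD r (max 1 a)) (t.flatMap (blockD r)) p (headsAvoid_blockD _ _ _ hne)
      (headsAvoid_blockD _ _ _ fun β hβ γ hγ => (hne γ hγ β hβ).symm)
      (by rw [blockD_mul_of_eq hx h2 b a hab ha p, zero_mul, zero_add])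
      (flatMap_blockD_mul hx h2 b a hab hb p t (hp.2.1.2.imp fun h => h.ne)
        fun d hd => ⟨hp.2.1.1 d hd, hr d (by simp [hd])⟩)
    rw [this, zero_mul, zero_add]

end RootVectors

section SerreImage

variable {r : ℕ} {k : Fin r → ℕ} {Q : Type*} [Ring Q] [Algebra (RF r k) Q]
  (φ : FreeA r k →ₐ[RF r k] Q)

attribute [local instance] LieRing.ofAssociativeRing

/-- The images of the generators along the chain `s, 3, 4, …` (`0`-based: `s, 2, 3, …`), starting
at position `1`. -/
def genChain (s n : ℕ) : Q :=
  if n = 0 then 0 else if n = 1 then φ (fgen r k s) else φ (fgen r k n)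

lemma map_lieBr (a b : FreeA r k) : φ (lieBr a b) = ⁅φ a, φ b⁆ := by
  simp [lieBr, Ring.lie_def]

lemma lie_fgen_eq_zero (hφ : ∀ y ∈ serreD r k, φ y = 0) (m n : ℕ) (hmn : m ≠ n)
    (h : ∀ a b : Fin r, (a : ℕ) = m → (b : ℕ) = n → ¬ adjD r a b) :
    ⁅φ (fgen r k m), φ (fgen r k n)⁆ = 0 := by
  rw [fgen, fgen]
  split_ifs with h1 h2
  · rw [← map_lieBr]
    exact hφ _ (Or.inl ⟨⟨m, h1⟩, ⟨n, h2⟩, by simpa using hmn, h _ _ rfl rfl, rfl⟩)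
  all_goals simp

lemma lie_lie_fgen_eq_zero (hφ : ∀ y ∈ serreD r k, φ y = 0) (m n : ℕ)
    (h : ∀ a b : Fin r, (a : ℕ) = m → (b : ℕ) = n → adjD r a b) :
    ⁅φ (fgen r k m), ⁅φ (fgen r k m), φ (fgen r k n)⁆⁆ = 0 := by
  rw [fgen, fgen]
  split_ifs with h1 h2
  · rw [← map_lieBr, ← map_lieBr]
    exact hφ _ (Or.inr ⟨⟨m, h1⟩, ⟨n, h2⟩, h _ _ rfl rfl, rfl⟩)
  all_goals simp

lemma isSerreChain_genChain (hφ : ∀ y ∈ serreD r k, φ y = 0) (s : ℕ) (hs : s ≤ 1) :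
    IsSerreChain (genChain φ s) := by
  constructor
  · intro i j hij
    rcases i with _ | _ | i
    · simp [genChain]
    · simp only [genChain, if_neg (by omega : j ≠ 0), if_neg (by omega : j ≠ 1)]
      refine lie_fgen_eq_zero φ hφ _ _ (by omega) fun a b ha hb => ?_
      simp only [adjD, ha, hb]
      omega
    · simp only [genChain, if_neg (by omega : j ≠ 0), if_neg (by omega : j ≠ 1)]
      refine lie_fgen_eq_zero φ hφ _ _ (by omega) fun a b ha hb => ?_
      simp only [adjD, ha, hb]
      omega
  · intro i
    rcases i with _ | _ | i
    · simp [genChain]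
    all_goals
      refine lie_lie_fgen_eq_zero φ hφ _ _ fun a b ha hb => ?_
      simp only [adjD, ha, hb]
      omega
  · intro i
    rcases i with _ | _ | i
    · simp [genChain]
    all_goals
      refine lie_lie_fgen_eq_zero φ hφ _ _ fun a b ha hb => ?_
      simp only [adjD, ha, hb]
      omega

lemma map_listBracket (s c a m : ℕ) (hc : 1 ≤ c) (ha : φ (fgen r k a) = genChain φ s c) :
    φ (listBracket r k ((List.range' (c + 1) m).reverse ++ [a])) =
      chainBracket (genChain φ s) c m := by
  induction m with
  | zero => simpa [listBracket, chainBracket] using ha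
  | succ m ih =>
    have hcons : ∀ (y : ℕ) (l : List ℕ), l ≠ [] →
        listBracket r k (y :: l) = lieBr (fgen r k y) (listBracket r k l) := by
      intro y l hl
      obtain ⟨b, l, rfl⟩ := List.exists_cons_of_ne_nil hl
      rfl
    rw [List.range'_1_concat, List.reverse_append, List.reverse_singleton, List.singleton_append,
      List.cons_append, hcons _ _ (by simp), map_lieBr, ih, chainBracket]
    congr 1
    rw [genChain, if_neg (by omega), if_neg (by omega)]
    congr 2
    omega

lemma map_FplusD (s : ℕ) (j : ℕ) (hs : s = 0) :
    φ (FplusD r k j) = chainBracket (genChain φ s) 1 (j - 1) :=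
  map_listBracket φ s 1 0 (j - 1) le_rfl (by rw [hs]; rfl)

lemma map_FminusD (s i j : ℕ) (hij : i < j) (hs : i = 0 → s = 1) :
    φ (FminusD r k i j) = chainBracket (genChain φ s) (i + 1) (j - (i + 1)) := by
  rw [← map_listBracket φ s (i + 1) (i + 1) (j - (i + 1)) (by omega)]
  · rw [FminusD]
    congr 2
    have : j - i = (j - (i + 1)) + 1 := by omega
    rw [this, List.range'_succ, List.reverse_cons]
  · rcases i with _ | i
    · rw [hs rfl]; rfl
    · rfl

lemma map_FpowD (b : ℕ) (hb : b ≤ 1) (p : RootD r →₀ ℕ)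
    (hp : ∀ β, headD r β = b → p β = 0) :
    φ (FpowD r k p) = pbwWord (rootVec (genChain φ (1 - b)) b) (enumD r) p := by
  have hpl : ∀ j, φ (FplusD r k j ^ pPlusD r p j) =
      pbwWord (rootVec (genChain φ (1 - b)) b) (plusListD r j) p := by
    intro j
    rw [pPlusD, plusListD]
    split_ifs with h
    · simp only [pbwWord, List.map_singleton, List.prod_singleton]
      by_cases hd : headD r (.inr ⟨⟨j, h.1⟩, h.2⟩) = b
      · rw [hp _ hd, pow_zero, pow_zero, map_one]
      · rw [map_pow, rootVec, if_neg hd, map_FplusD φ (1 - b) j (by simp only [headD] at hd; omega)]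
        rfl
    · simp [pbwWord]
  have hmi : ∀ j i, φ (FminusD r k i j ^ pMinusD r p i j) =
      pbwWord (rootVec (genChain φ (1 - b)) b) (minusListD r i j) p := by
    intro j i
    rw [pMinusD, minusListD]
    split_ifs with h
    · simp only [pbwWord, List.map_singleton, List.prod_singleton]
      by_cases hd : headD r (.inl ⟨(⟨i, h.1⟩, ⟨j, h.2.1⟩), Fin.mk_lt_mk.mpr h.2.2⟩) = b
      · rw [hp _ hd, pow_zero, pow_zero, map_one]
      · rw [map_pow, rootVec, if_neg hd, map_FminusD φ (1 - b) i j h.2.2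
          (by simp only [headD] at hd; omega)]
        simp [headD, jIdxD]
    · simp [pbwWord]
  have hflat : ∀ (js : List ℕ) (f : ℕ → List (RootD r)),
      pbwWord (rootVec (genChain φ (1 - b)) b) (js.flatMap f) p =
        (js.map fun j => pbwWord (rootVec (genChain φ (1 - b)) b) (f j) p).prod := by
    intro js f
    induction js with
    | nil => rfl
    | cons j js ih => rw [List.flatMap_cons, pbwWord_append, ih, List.map_cons, List.prod_cons]
  rw [FpowD, enumD, hflat, map_list_prod, List.map_map]
  congr 1
  refine List.map_congr_left fun j _ => ?_
  rw [Function.comp_apply, map_mul, hpl, map_list_prod, List.map_map, blockD, pbwWord_append, hflat]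
  congr 2
  exact List.map_congr_left fun i _ => hmi j i

lemma pbwWord_mul_gen (hφ : ∀ y ∈ serreD r k, φ y = 0) (hr : 4 ≤ r) (b : ℕ) (hb : b ≤ 1)
    (a : Fin r) (hab : (a : ℕ) ≠ b) (p : RootD r →₀ ℕ) :
    pbwWord (rootVec (genChain φ (1 - b)) b) (enumD r) p * φ (FreeAlgebra.ι (RF r k) a) =
      ∑ β, if headD r β = a then
        (match restD r β with
        | none => pbwWord (rootVec (genChain φ (1 - b)) b) (enumD r) (p + Finsupp.single β 1)
        | some c => (p c : RF r k) • pbwWord (rootVec (genChain φ (1 - b)) b) (enumD r)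
            (p - Finsupp.single c 1 + Finsupp.single β 1)) else 0 := by
  have h2 : ∀ y : Q, y + y = 0 → y = 0 := fun y hy => by
    have : (2 : RF r k) • y = 0 := by rw [two_smul, hy]
    have h3 := congrArg (fun z => (2 : RF r k)⁻¹ • z) this
    simpa [smul_smul] using h3
  have hgen : φ (FreeAlgebra.ι (RF r k) a) = genChain φ (1 - b) (max 1 a) := by
    have hf : fgen r k a = FreeAlgebra.ι (RF r k) a := by rw [fgen, dif_pos a.2]
    rw [← hf, genChain, if_neg (by omega)]
    split_ifs with h
    · congr 2; omega
    · congr 2; omega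
  rw [hgen, enumD_mul (isSerreChain_genChain φ hφ (1 - b) (by omega)) h2 b a hab hb (by omega)]
  refine sum_congr rfl fun β _ => ?_
  split_ifs
  · rw [pbwMult, pbwStep]
    rcases restD r β with _ | c
    · exact one_smul _ _
    · exact (Nat.cast_smul_eq_nsmul _ _ _).symm
  · rfl

end SerreImage

section ColorPerm

variable {r : ℕ} {k : Fin r → ℕ}

/-- The action of a family of permutations on the variables. -/
def permVar (π : ∀ i, Equiv.Perm (Fin (k i))) (v : SVars r k) : SVars r k := ⟨v.1, π v.1 v.2⟩

lemma permVar_bijective (π : ∀ i, Equiv.Perm (Fin (k i))) : Function.Bijective (permVar π) :=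
  (Equiv.sigmaCongrRight π).bijective

lemma exists_permVar_eq (σ : SVars r k → SVars r k) (hσ : Function.Injective σ)
    (h : ∀ v, (σ v).1 = v.1) : ∃ π, permVar π = σ := by
  have h' : ∀ i c, ∃ d : Fin (k i), σ ⟨i, c⟩ = ⟨i, d⟩ := by
    intro i c
    rcases hv : σ ⟨i, c⟩ with ⟨j, d⟩
    have := h ⟨i, c⟩
    rw [hv] at this
    dsimp only at this
    subst this
    exact ⟨d, rfl⟩
  choose d hd using h'
  have hinj : ∀ i, Function.Injective (d i) := fun i c c' hc => by
    have := hσ (a₁ := ⟨i, c⟩) (a₂ := ⟨i, c'⟩) (by rw [hd, hd, hc])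
    simpa using this
  refine ⟨fun i => Equiv.ofBijective (d i) (Finite.injective_iff_bijective.mp (hinj i)), ?_⟩
  funext v
  exact (hd v.1 v.2).symm

lemma sum_permVar {ι M : Type*} [Fintype ι] [DecidableEq ι] [AddCommMonoid M] (s : ι → SVars r k)
    (hs : Function.Bijective s) (f : (ι → SVars r k) → M) :
    ∑ π, f (fun u => permVar π (s u)) =
      ∑ e : ι → SVars r k, if (∀ u, (e u).1 = (s u).1) ∧ Function.Bijective e then f e else 0 := by
  rw [← sum_filter]
  refine sum_bij (fun π _ u => permVar π (s u)) ?_ ?_ ?_ fun _ _ => rfl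
  · intro π _
    rw [mem_filter]
    exact ⟨mem_univ _, fun u => rfl, (permVar_bijective π).comp hs⟩
  · intro π _ π' _ h
    funext i
    ext c : 1
    obtain ⟨u, hu⟩ := hs.2 ⟨i, c⟩
    have h' : permVar π (s u) = permVar π' (s u) := congrFun h u
    rw [hu] at h'
    simpa [permVar] using h'
  · intro e he
    rw [mem_filter] at he
    obtain ⟨π, hπ⟩ := exists_permVar_eq (fun v => e ((Equiv.ofBijective s hs).symm v))
      (he.2.2.1.comp (Equiv.injective _)) (fun v => by
        rw [he.2.1, ← Equiv.ofBijective_apply s hs, Equiv.apply_symm_apply])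
    refine ⟨π, mem_univ _, ?_⟩
    funext u
    refine (congrFun hπ (s u)).trans (congrArg e ?_)
    exact (Equiv.ofBijective s hs).symm_apply_apply u

lemma card_color (i : Fin r) : #{v : SVars r k | v.1 = i} = k i := by
  refine Eq.trans ?_ (Finset.card_fin (k i))
  refine card_bij' (fun v hv => Fin.cast (by rw [(mem_filter.mp hv).2]) v.2) (fun c _ => ⟨i, c⟩)
    ?_ ?_ ?_ ?_
  · simp
  · simp
  · rintro ⟨j, c⟩ h
    obtain rfl : j = i := (mem_filter.mp h).2
    rfl
  · simp

lemma card_color_of_bijective {ι : Type*} [Fintype ι] (e : ι → SVars r k)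
    (he : Function.Bijective e) (i : Fin r) : #{u | (e u).1 = i} = k i := by
  rw [← card_color (k := k) i]
  refine card_bij (fun u _ => e u) ?_ (fun _ _ _ _ h => he.1 h) ?_
  · simp
  · intro v hv
    obtain ⟨u, rfl⟩ := he.2 v
    exact ⟨u, by simpa using hv, rfl⟩

end ColorPerm

lemma chainWeight_ofFn {K : Type*} [Field K] (n : ℕ) (g : ℕ → K) :
    chainWeight (g 0) (List.ofFn fun i : Fin n => g (i + 1)) =
      ∏ u ∈ range n, (g (u + 1) - g u)⁻¹ := by
  induction n generalizing g with
  | zero => simp [chainWeight]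
  | succ n ih =>
    rw [List.ofFn_succ, chainWeight, prod_range_succ', mul_comm]
    congr 1
    exact ih fun u => g (u + 1)

lemma ofFn_reverse {α : Type*} {n : ℕ} (f : Fin n → α) :
    (List.ofFn f).reverse = List.ofFn fun u => f u.rev := by
  refine List.ext_getElem (by simp) fun i h1 h2 => ?_
  simp only [List.getElem_reverse, List.getElem_ofFn, List.length_ofFn]
  congr 1
  ext
  simp [Fin.val_rev]
  omega

section MultiIndex

variable {r : ℕ} {k : Fin r → ℕ}

lemma posCount_lt {n : ℕ} {J : Fin n → Fin r} (hJ : IsContent r J k) (u : Fin n) :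
    posCount J u < k (J u) := by
  rw [← hJ (J u), posCount]
  refine card_lt_card ⟨fun v hv => ?_, fun h => ?_⟩
  · rw [mem_filter] at hv ⊢
    exact ⟨hv.1, hv.2.1⟩
  · have := h (show u ∈ univ.filter fun v => J v = J u by simp)
    simp at this

/-- The variable attached to a position of a multi-index. -/
def posVar {n : ℕ} (J : Fin n → Fin r) (hJ : IsContent r J k) (u : Fin n) : SVars r k :=
  ⟨J u, ⟨posCount J u, posCount_lt hJ u⟩⟩

lemma posCount_lt_posCount {n : ℕ} (J : Fin n → Fin r) {u v : Fin n} (h : J u = J v)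
    (huv : u < v) : posCount J u < posCount J v := by
  rw [posCount, posCount]
  refine card_lt_card ⟨fun w hw => ?_, fun h' => ?_⟩
  · rw [mem_filter] at hw ⊢
    exact ⟨hw.1, hw.2.1.trans h, hw.2.2.trans huv⟩
  · have := h' (show u ∈ univ.filter fun w => J w = J v ∧ w < v by simp [h, huv])
    simp at this

lemma posVar_bijective (J : Fin (∑ i, k i) → Fin r) (hJ : IsContent r J k) :
    Function.Bijective (posVar J hJ) := by
  rw [Fintype.bijective_iff_injective_and_card]
  constructor
  · intro u v h
    have h1 : J u = J v := congrArg Sigma.fst h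
    have h2 : posCount J u = posCount J v := by
      have := congrArg (fun w : SVars r k => (w.2 : ℕ)) h
      exact this
    rcases lt_trichotomy u v with h3 | h3 | h3
    · have := posCount_lt_posCount J h1 h3; omega
    · exact h3
    · have := posCount_lt_posCount J h1.symm h3; omega
  · simp [Fintype.card_sigma]

lemma chainRF_succ {n : ℕ} (J : Fin n → Fin r) (hJ : IsContent r J k)
    (π : ∀ i, Equiv.Perm (Fin (k i))) (u : Fin n) :
    chainRF r k J π (u + 1) = Xv r k (permVar π (posVar J hJ u)) := by
  rw [chainRF, dif_pos u.2, dif_pos (posCount_lt hJ u)]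
  rfl

theorem sum_omegaRF_smul {Q : Type*} [Ring Q] [Algebra (RF r k) Q]
    (φ : FreeA r k →ₐ[RF r k] Q) :
    ∑ J ∈ univ.filter (fun J : Fin (∑ i, k i) → Fin r => IsContent r J k),
      omegaRF r k J • φ (monJ r k J) =
    orderSum (Xv r k) (fun v => φ (FreeAlgebra.ι (RF r k) v.1)) (∑ i, k i) 0 univ := by
  set f : (Fin (∑ i, k i) → SVars r k) → Q := fun e =>
    chainWeight 0 ((List.ofFn e).map (Xv r k)) •
      ((List.ofFn e).map fun v => φ (FreeAlgebra.ι (RF r k) v.1)).reverse.prod with hf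
  have h1 : ∀ J ∈ univ.filter (fun J : Fin (∑ i, k i) → Fin r => IsContent r J k),
      omegaRF r k J • φ (monJ r k J) = ∑ e : Fin (∑ i, k i) → SVars r k,
        if (∀ u, (e u).1 = J u) ∧ Function.Bijective e then f e else 0 := by
    intro J hJ
    have hJ := (mem_filter.mp hJ).2
    refine Eq.trans ?_ ((sum_permVar (posVar J hJ) (posVar_bijective J hJ) f).trans
      (sum_congr rfl fun e _ => by split_ifs <;> tauto))
    rw [omegaRF, sum_smul]
    refine sum_congr rfl fun π _ => ?_
    rw [hf]
    congr 1
    · rw [← chainWeight_ofFn, List.map_ofFn]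
      congr 2
      funext u
      exact chainRF_succ J hJ π u
    · rw [monJ, map_list_prod, List.map_ofFn, List.map_ofFn, ofFn_reverse]
      rfl
  rw [sum_congr rfl h1, sum_comm, orderSum]
  refine sum_congr rfl fun e _ => ?_
  have hb : Function.Bijective e ↔ Function.Injective e ∧ univ.image e = univ := by
    rw [Function.Bijective, eq_univ_iff_forall]
    simp [Function.Surjective]
  rw [if_congr hb.symm rfl rfl]
  by_cases he : Function.Bijective e
  · rw [if_pos he, sum_eq_single fun u => (e u).1]
    · rw [if_pos ⟨fun _ => rfl, he⟩]
    · intro J _ hne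
      exact if_neg fun h => hne (funext fun u => (h.1 u).symm)
    · intro h
      exact absurd (mem_filter.mpr ⟨mem_univ _, fun i => card_color_of_bijective e he i⟩) h
  · rw [if_neg he]
    exact sum_eq_zero fun J _ => if_neg fun h => he h.2

end MultiIndex

section Slots

variable {r : ℕ} {k : Fin r → ℕ}

variable (r) in
/-- The list of (0-based) colors of a chain root, in the order of the chain. -/
def listD (β : RootD r) : List ℕ := headD r β :: tailD r β

lemma mem_listD {β : RootD r} {u : ℕ} :
    u ∈ listD r β ↔ u = headD r β ∨ (max 1 (headD r β) < u ∧ u < jIdxD r β) := by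
  rw [listD, List.mem_cons, tailD, List.mem_range'_1]
  have := max_headD_lt β
  omega

lemma nodup_listD (β : RootD r) : (listD r β).Nodup := by
  rw [listD, List.nodup_cons, tailD]
  refine ⟨fun h => ?_, List.nodup_range'⟩
  rw [List.mem_range'_1] at h
  omega

lemma listD_lt {β : RootD r} {u : ℕ} (hu : u ∈ listD r β) : u < r := by
  rw [mem_listD] at hu
  have := max_headD_lt β
  have := jIdxD_le β
  omega

lemma contD_eq (β : RootD r) (u : Fin r) :
    contD r β u = if (u : ℕ) ∈ listD r β then 1 else 0 := by
  rcases β with ⟨⟨i, j⟩, h⟩ | ⟨v, h⟩ <;> simp only [contD, mem_listD, headD, jIdxD]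
  · have : (i : ℕ) < j := h
    exact if_congr (by omega) rfl rfl
  · exact if_congr (by omega) rfl rfl

lemma sum_get_eq {α : Type*} [DecidableEq α] (l : List α) (hl : l.Nodup) (a : α) :
    (∑ j : Fin l.length, if l.get j = a then 1 else 0) = if a ∈ l then 1 else 0 := by
  by_cases ha : a ∈ l
  · obtain ⟨j, hj⟩ := List.get_of_mem ha
    rw [if_pos ha, sum_eq_single j, if_pos hj]
    · intro i _ hij
      exact if_neg fun h => hij (List.nodup_iff_injective_get.mp hl (h.trans hj.symm))
    · simp
  · rw [if_neg ha]
    exact sum_eq_zero fun j _ => if_neg fun h : l.get j = a => ha (h ▸ List.get_mem l j)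

/-- The positions of all chains in a product of `p β` chains for every root `β`. -/
abbrev SlotD (p : RootD r → ℕ) :=
  (l : (β : RootD r) × Fin (p β)) × Fin (listD r l.1).length

/-- The color of a position. -/
def slotColor {p : RootD r → ℕ} (q : SlotD p) : Fin r :=
  ⟨(listD r q.1.1).get q.2, listD_lt (List.get_mem _ _)⟩

lemma contD_slotColor {p : RootD r → ℕ} (q : SlotD p) : contD r q.1.1 (slotColor q) = 1 := by
  rw [contD_eq]
  exact if_pos (List.get_mem _ _)

lemma card_slotColor (p : RootD r → ℕ) (i : Fin r) :
    #{q : SlotD p | slotColor q = i} = ∑ β, p β * contD r β i := by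
  rw [card_filter, Fintype.sum_sigma, Fintype.sum_sigma]
  refine sum_congr rfl fun β _ => ?_
  have h : ∀ c : Fin (p β), (∑ j : Fin (listD r β).length,
      if slotColor (p := p) ⟨⟨β, c⟩, j⟩ = i then 1 else 0) = contD r β i := by
    intro c
    rw [contD_eq, ← sum_get_eq _ (nodup_listD β)]
    exact sum_congr rfl fun j _ => if_congr Fin.ext_iff rfl rfl
  rw [sum_congr rfl fun c _ => h c]
  simp

lemma not_beforeD_self (β : RootD r) : ¬ beforeD r β β := by
  rw [beforeD]
  omega

lemma beforeD_trans {β γ δ : RootD r} (h : beforeD r β γ) (h' : beforeD r γ δ) :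
    beforeD r β δ := by
  rw [beforeD] at *
  omega

lemma beforeD_total (β γ : RootD r) : beforeD r β γ ∨ β = γ ∨ beforeD r γ β := by
  by_cases h : headD r β = headD r γ ∧ jIdxD r β = jIdxD r γ
  · exact Or.inr (Or.inl (rootD_ext h.1 h.2))
  · have h1 : ∀ δ : RootD r, subIdxD r δ = headD r δ := fun _ => rfl
    simp only [beforeD, h1]
    omega

lemma sum_filter_beforeD_le (p : RootD r → ℕ) {β γ : RootD r} (h : beforeD r β γ) (u : Fin r) :
    ∑ δ ∈ univ.filter (fun x => beforeD r x β), p δ * contD r δ u + p β * contD r β u ≤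
      ∑ δ ∈ univ.filter (fun x => beforeD r x γ), p δ * contD r δ u := by
  rw [add_comm, ← sum_insert (f := fun δ => p δ * contD r δ u) (by simp [not_beforeD_self])]
  refine sum_le_sum_of_subset fun δ hδ => ?_
  simp only [mem_insert, mem_filter, mem_univ, true_and] at hδ ⊢
  rcases hδ with rfl | hδ
  · exact h
  · exact beforeD_trans hδ h

lemma sum_filter_beforeD_add_le (p : RootD r → ℕ) (β : RootD r) (u : Fin r) :
    ∑ δ ∈ univ.filter (fun x => beforeD r x β), p δ * contD r δ u + p β * contD r β u ≤
      ∑ δ, p δ * contD r δ u := by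
  rw [add_comm, ← sum_insert (f := fun δ => p δ * contD r δ u) (by simp [not_beforeD_self])]
  exact sum_le_sum_of_subset (subset_univ _)

lemma offD_lt (p : RootD r → ℕ) {β : RootD r} {c : ℕ} (hc : c < p β) {u : Fin r}
    (hu : contD r β u = 1) : offD r p β c u <
      ∑ δ ∈ univ.filter (fun x => beforeD r x β), p δ * contD r δ u + p β * contD r β u := by
  rw [offD, hu]
  omega

/-- The variable at a position of the star product before symmetrization. -/
def slotVar (p : RootD r → ℕ) (hp : ∀ u : Fin r, ∑ β : RootD r, p β * contD r β u = k u)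
    (q : SlotD p) : SVars r k :=
  ⟨slotColor q, ⟨offD r p q.1.1 q.1.2 (slotColor q),
    (offD_lt p q.1.2.2 (contD_slotColor q)).trans_le
      ((sum_filter_beforeD_add_le p q.1.1 _).trans_eq (hp _))⟩⟩

lemma slotVar_injective (p : RootD r → ℕ)
    (hp : ∀ u : Fin r, ∑ β : RootD r, p β * contD r β u = k u) :
    Function.Injective (slotVar p hp) := by
  have hlt : ∀ q q' : SlotD p, slotColor q = slotColor q' → beforeD r q.1.1 q'.1.1 →
      offD r p q.1.1 q.1.2 (slotColor q) < offD r p q'.1.1 q'.1.2 (slotColor q') := by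
    intro q q' h hb
    refine (offD_lt p q.1.2.2 (contD_slotColor q)).trans_le ?_
    refine (sum_filter_beforeD_le p hb _).trans ?_
    rw [h, offD]
    exact Nat.le_add_right _ _
  intro q q' h
  have h1 : slotColor q = slotColor q' := congrArg Sigma.fst h
  have h2 : offD r p q.1.1 q.1.2 (slotColor q) = offD r p q'.1.1 q'.1.2 (slotColor q') :=
    congrArg (fun w : SVars r k => (w.2 : ℕ)) h
  rcases beforeD_total q.1.1 q'.1.1 with h3 | h3 | h3
  · exact absurd h2 (hlt q q' h1 h3).ne
  · have h4 := contD_slotColor q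
    have h5 := contD_slotColor q'
    obtain ⟨⟨β, c⟩, i⟩ := q
    obtain ⟨⟨β', c'⟩, i'⟩ := q'
    dsimp only at h3
    subst h3
    rw [← h1, offD, offD, h4] at h2
    have h6 : c = c' := Fin.ext (by simpa using h2)
    subst h6
    have h7 : (listD r β).get i = (listD r β).get i' := congrArg Fin.val h1
    have h8 := List.nodup_iff_injective_get.mp (nodup_listD β) h7
    rw [h8]
  · exact absurd h2 (hlt q' q h1.symm h3).ne'

lemma slotVar_bijective (p : RootD r → ℕ)
    (hp : ∀ u : Fin r, ∑ β : RootD r, p β * contD r β u = k u) :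
    Function.Bijective (slotVar p hp) := by
  rw [Fintype.bijective_iff_injective_and_card]
  refine ⟨slotVar_injective p hp, ?_⟩
  rw [← card_univ, card_eq_sum_card_fiberwise (t := univ) (f := slotColor) (fun _ _ => mem_univ _),
    sum_congr rfl fun i _ => (card_slotColor p i).trans (hp i)]
  simp [Fintype.card_sigma]

end Slots

section Weights

lemma chainWeight_range' {K : Type*} [Field K] (h : ℕ → K) (c n : ℕ) :
    chainWeight (h c) ((List.range' c n).map fun u => h (u + 1)) =
      ∏ u ∈ Icc (c + 1) (c + n), (h u - h (u - 1))⁻¹ := by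
  induction n generalizing c with
  | zero => simp [chainWeight]
  | succ n ih =>
    have h1 : Icc (c + 1) (c + (n + 1)) = insert (c + 1) (Icc (c + 1 + 1) (c + 1 + n)) := by
      ext u
      simp only [mem_Icc, mem_insert]
      omega
    rw [List.range'_succ, List.map_cons, chainWeight, ih, h1, prod_insert (by simp)]
    rfl

lemma ofFn_get_map {α β : Type*} (l : List α) (h : α → β) :
    (List.ofFn fun i : Fin l.length => h (l.get i)) = l.map h :=
  List.ext_getElem (by simp) fun i h1 h2 => by simp

variable {r : ℕ} {k : Fin r → ℕ}

lemma etaD_eq_chainWeight (p : RootD r → ℕ) (π : ∀ i, Equiv.Perm (Fin (k i))) (β : RootD r)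
    (c : ℕ) : etaD r k p π β c =
      chainWeight 0 ((listD r β).map fun u => tvD r k p π β c (u + 1) 1) := by
  rcases β with ⟨⟨i, j⟩, hij⟩ | ⟨v, hv⟩
  · have hij' : (i : ℕ) < j := hij
    have hl : listD r (.inl ⟨(i, j), hij⟩) =
        ((i : ℕ) + 1) :: List.range' ((i : ℕ) + 2) ((j : ℕ) - (i + 1)) := by
      simp only [listD, headD, tailD, jIdxD]
      congr 2
    rw [hl, List.map_cons, chainWeight, sub_zero, etaD]
    refine congrArg _ (Eq.trans ?_ (chainWeight_range'
      (fun u => tvD r k p π (.inl ⟨(i, j), hij⟩) c u 1) _ _).symm)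
    have : (i : ℕ) + 2 + (j - (i + 1)) = j + 1 := by omega
    rw [this]
  · have hv' : 0 < (v : ℕ) := hv
    have hl : listD r (.inr ⟨v, hv⟩) = 0 :: List.range' 2 ((v : ℕ) - 1) := rfl
    rw [hl, List.map_cons, chainWeight, sub_zero, etaD]
    split_ifs with h1
    · have h1 : (v : ℕ) = 1 := h1
      simp [h1, chainWeight]
    · have h1 : (v : ℕ) ≠ 1 := h1
      have h2 : (v : ℕ) - 1 = (v - 2) + 1 := by omega
      rw [h2, List.range'_succ, List.map_cons, chainWeight, mul_assoc]
      refine congrArg _ (congrArg _ (Eq.trans ?_ (chainWeight_range'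
        (fun u => tvD r k p π (.inr ⟨v, hv⟩) c u 1) 3 _).symm))
      have : 3 + ((v : ℕ) - 2) = v + 1 := by omega
      rw [this]

lemma tvD_slot (p : RootD r → ℕ) (hp : ∀ u : Fin r, ∑ β : RootD r, p β * contD r β u = k u)
    (π : ∀ i, Equiv.Perm (Fin (k i))) (q : SlotD p) :
    tvD r k p π q.1.1 q.1.2 ((listD r q.1.1).get q.2 + 1) 1 =
      Xv r k (permVar π (slotVar p hp q)) := by
  rw [tvD]
  exact (dif_pos (slotColor q).2).trans (dif_pos (slotVar p hp q).2.2)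

lemma fillingSum_eq (p : RootD r → ℕ)
    (hp : ∀ u : Fin r, ∑ β : RootD r, p β * contD r β u = k u) :
    fillingSum (Xv r k) (fun v => (v.1 : ℕ)) (listD r) 0 p =
      ∑ π : ∀ i, Equiv.Perm (Fin (k i)), ∏ β : RootD r, ∏ c ∈ range (p β), etaD r k p π β c := by
  have h1 := sum_permVar (slotVar p hp) (slotVar_bijective p hp) fun e : SlotD p → SVars r k =>
    ∏ l : (β : RootD r) × Fin (p β),
      chainWeight 0 ((List.ofFn fun i => e ⟨l, i⟩).map (Xv r k))
  refine Eq.trans ?_ (h1.symm.trans (sum_congr rfl fun π _ => ?_))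
  · refine (Fintype.sum_equiv (Equiv.piCurry fun _ _ => SVars r k) _ _ fun e => ?_).symm
    refine if_congr (and_congr ?_ Iff.rfl) rfl rfl
    rw [Sigma.forall]
    exact forall_congr' fun l => forall_congr' fun i => Fin.ext_iff
  · rw [Fintype.prod_sigma]
    refine prod_congr rfl fun β _ => ?_
    rw [← Fin.prod_univ_eq_prod_range]
    refine prod_congr rfl fun c _ => ?_
    rw [List.map_ofFn, etaD_eq_chainWeight, ← ofFn_get_map]
    congr 2
    funext i
    exact (tvD_slot p hp π ⟨⟨β, c⟩, i⟩).symm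

lemma fillingSum_eq_zero (p : RootD r → ℕ)
    (hp : ¬ ∀ u : Fin r, ∑ β : RootD r, p β * contD r β u = k u) :
    fillingSum (Xv r k) (fun v => (v.1 : ℕ)) (listD r) 0 p = 0 := by
  refine sum_eq_zero fun e _ => if_neg fun h => hp fun u => ?_
  rw [← card_slotColor, ← card_color_of_bijective _ h.2 u]
  congr 1
  ext q
  simp only [mem_filter, mem_univ, true_and, Fin.ext_iff]
  rw [show ((e q.1 q.2).1 : ℕ) = slotColor q from h.1 q.1 q.2]

end Weights

section Assembly

variable {r : ℕ} {k : Fin r → ℕ}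

lemma Xv_injective : Function.Injective (Xv r k) :=
  (IsFractionRing.injective (MvPolynomial (SVars r k) ℂ) (RF r k)).comp MvPolynomial.X_injective

lemma Xv_ne_zero (v : SVars r k) : Xv r k v ≠ 0 := by
  rw [Xv, Ne, IsFractionRing.to_map_eq_zero_iff]
  exact MvPolynomial.X_ne_zero v

lemma sum_eq_sum_content (p : RootD r → ℕ)
    (hp : ∀ u : Fin r, ∑ β : RootD r, p β * contD r β u = k u) :
    ∑ β, p β ≤ ∑ u, k u := by
  rw [← sum_congr rfl fun u _ => hp u, sum_comm]
  refine sum_le_sum fun β _ => ?_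
  have hβ : headD r β ∈ listD r β := List.mem_cons_self
  refine le_trans ?_ (single_le_sum (f := fun u => p β * contD r β u) (fun _ _ => Nat.zero_le _)
    (mem_univ (⟨headD r β, listD_lt hβ⟩ : Fin r)))
  rw [contD_eq, if_pos hβ, mul_one]

lemma eq_zero_of_content (p : RootD r → ℕ)
    (hp : ∀ u : Fin r, ∑ β : RootD r, p β * contD r β u = k u) (b : Fin r) (hb : k b = 0)
    (β : RootD r) (hβ : headD r β = b) : p β = 0 := by
  have h1 := hp b
  rw [hb, sum_eq_zero_iff] at h1
  have h2 := h1 β (mem_univ β)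
  rw [contD_eq, if_pos (hβ ▸ List.mem_cons_self), mul_one] at h2
  exact h2

lemma color_ne_of_eq_zero (b : Fin r) (hb : k b = 0) (v : SVars r k) : (v.1 : ℕ) ≠ b := by
  obtain ⟨i, c⟩ := v
  rintro h
  obtain rfl : i = b := Fin.ext h
  have := c.2
  omega

lemma finsum_content {M : Type*} [AddCommMonoid M] (f : (RootD r → ℕ) → M) :
    ∑ᶠ p : {p : RootD r → ℕ // ∀ u : Fin r, ∑ β : RootD r, p β * contD r β u = k u}, f p.val =
      ∑ n ∈ range (∑ u, k u + 1), ∑ p ∈ piAntidiag univ n,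
        if ∀ u : Fin r, ∑ β : RootD r, p β * contD r β u = k u then f p else 0 := by
  have hdisj : Set.PairwiseDisjoint (range (∑ u, k u + 1) : Set ℕ)
      fun n => piAntidiag (univ : Finset (RootD r)) n := fun m _ n _ hmn =>
    disjoint_left.mpr fun p hm hn =>
      hmn ((mem_piAntidiag.mp hm).1.symm.trans (mem_piAntidiag.mp hn).1)
  rw [← sum_biUnion hdisj, ← sum_filter, ← finsum_mem_coe_finset]
  refine (finsum_set_coe_eq_finsum_mem (f := f)
    {p : RootD r → ℕ | ∀ u : Fin r, ∑ β : RootD r, p β * contD r β u = k u}).trans ?_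
  refine congrArg (fun s : Set (RootD r → ℕ) => ∑ᶠ p ∈ s, f p) (Set.ext fun p => ?_)
  simp only [Set.mem_ofPred_eq, coe_filter, mem_biUnion, mem_range, mem_piAntidiag, mem_univ,
    implies_true, and_true]
  exact ⟨fun h => ⟨⟨_, Nat.lt_succ_of_le (sum_eq_sum_content p h), rfl⟩, h⟩, fun h => h.2⟩

variable {Q : Type*} [Ring Q] [Algebra (RF r k) Q]

theorem sum_omegaRF_smul_eq (φ : FreeA r k →ₐ[RF r k] Q) (hφ : ∀ y ∈ serreD r k, φ y = 0)
    (hr : 4 ≤ r) (b : Fin r) (hb : (b : ℕ) ≤ 1) (hk : k b = 0) :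
    ∑ J ∈ univ.filter (fun J : Fin (∑ i, k i) → Fin r => IsContent r J k),
      omegaRF r k J • φ (monJ r k J) =
    ∑ n ∈ range (∑ u, k u + 1), ∑ p ∈ piAntidiag univ n,
      if ∀ u : Fin r, ∑ β : RootD r, p β * contD r β u = k u then
        omegaP r k p • φ (FpowD r k p) else 0 := by
  set Fp : (RootD r →₀ ℕ) → Q := fun p =>
    pbwWord (rootVec (genChain φ (1 - b)) b) (enumD r) p with hFp
  have hF0 : Fp 0 = 1 := by simp [hFp, pbwWord]
  have h1 := pbwMap_expCoeff (Xv r k) Xv_injective (fun v => (v.1 : ℕ)) (headD r) (tailD r)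
    (restD r) (fun β => (tailD_eq β).trans (by rcases restD r β <;> rfl)) Fp hF0 (fun v => φ (FreeAlgebra.ι (RF r k) v.1))
    (fun v p => (pbwWord_mul_gen φ hφ hr b hb v.1 (color_ne_of_eq_zero b hk v) p).trans
      (sum_congr rfl fun β _ => by rcases restD r β <;> split_ifs <;> rfl))
    (∑ i, k i) (∑ i, k i) le_rfl 0 univ (by simp [Fintype.card_sigma])
    (fun v _ => Xv_ne_zero v)
  rw [sum_omegaRF_smul]
  refine Eq.trans (by convert h1.symm) ((pbwMap_expCoeff_univ _ _ _ _ _ _ _).trans ?_)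
  refine sum_congr rfl fun n _ => sum_congr (by congr) fun p _ => ?_
  split_ifs with hp
  · rw [omegaP, ← fillingSum_eq p hp]
    congr 1
    exact (map_FpowD φ b hb (Finsupp.equivFunOnFinite.symm p)
      (eq_zero_of_content p hp b hk)).symm
  · have h2 := fillingSum_eq_zero p hp
    change ((_ : RF r k) * fillingSum (Xv r k) (fun v => (v.1 : ℕ)) (listD r) 0 p) • _ = 0
    rw [h2, mul_zero, zero_smul]

end Assembly

/-- Poincaré–Birkhoff–Witt expansion of the canonical form, type `D_r`,
chain part: for `k ∈ ℕ^r` with `k_1 = 0` or `k_2 = 0`, modulo the two-sided ideal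
generated by the Serre relations, `Σ_J ω_J · f_{J(|k|)} ⋯ f_{J(1)} = Σ_p ω_p · F^p`,
where `J` ranges over the multi-indices of content `k` and `p` over the maps
`{chain roots} → ℕ` with `Σ_β p_β·c(β) = k`. -/
theorem pbw_expansion_D_chain (r : ℕ) (hr : 4 ≤ r) (k : Fin r → ℕ)
    (hk : k ⟨0, by omega⟩ = 0 ∨ k ⟨1, by omega⟩ = 0) :
    (∑ J ∈ univ.filter (fun J : Fin (∑ i, k i) → Fin r => IsContent r J k),
        algebraMap (RF r k) (FreeA r k) (omegaRF r k J) * monJ r k J) -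
      (∑ᶠ p : {p : RootD r → ℕ // ∀ u : Fin r, ∑ β : RootD r, p β * contD r β u = k u},
        algebraMap (RF r k) (FreeA r k) (omegaP r k p.val) * FpowD r k p.val) ∈
    TwoSidedIdeal.span (serreD r k) := by
  obtain ⟨b, hb, hkb⟩ : ∃ b : Fin r, (b : ℕ) ≤ 1 ∧ k b = 0 := by
    rcases hk with hk | hk
    · exact ⟨_, Nat.zero_le 1, hk⟩
    · exact ⟨_, le_rfl, hk⟩
  set I := TwoSidedIdeal.span (serreD r k)
  set φ := RingCon.mkₐ (RF r k) I.ringCon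
  have hφ : ∀ y, φ y = 0 ↔ y ∈ I := fun y => by
    rw [TwoSidedIdeal.mem_iff]
    exact RingCon.eq _
  rw [← hφ, map_sub, sub_eq_zero,
    finsum_content fun p => algebraMap (RF r k) (FreeA r k) (omegaP r k p) * FpowD r k p]
  simp only [map_sum, apply_ite φ, ← Algebra.smul_def, map_smul, map_zero]
  exact sum_omegaRF_smul_eq φ (fun y hy => (hφ y).mpr (TwoSidedIdeal.subset_span hy)) hr b hb hkb

end
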